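/- arXiv:math/0007136 — 4 statements merged into one kernel-verified Lean document; each statement's English description precedes it below -/
import Mathlib

section
/- Let G be a finite subgraph of the square lattice with equally many white and black vertices, with white vertices v_1,...,v_N and black vertices w_1,...,w_N, and let K(G) be its Kasteleyn–Wilson matrix. Then the number of perfect matchings of G equals the absolute value of det K(G). -/
open scoped Classical

/-- Two lattice points are at Euclidean distance 1. -/
def latAdj (p q : ℤ × ℤ) : Prop := |p.1 - q.1| + |p.2 - q.2| = 1

/-- The graph on `Fin N ⊕ Fin N` (left: white vertices, right: black vertices) determined by
the adjacency relation `E` between white and black indices. -/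
def latGraph (N : ℕ) (E : Fin N → Fin N → Prop) : SimpleGraph (Fin N ⊕ Fin N) where
  Adj x y := (∃ i j, x = Sum.inl i ∧ y = Sum.inr j ∧ E i j) ∨
             (∃ i j, x = Sum.inr j ∧ y = Sum.inl i ∧ E i j)
  symm := by
    refine ⟨?_⟩
    rintro x y (⟨i, j, h1, h2, he⟩ | ⟨i, j, h1, h2, he⟩)
    · exact Or.inr ⟨i, j, h2, h1, he⟩
    · exact Or.inl ⟨i, j, h2, h1, he⟩
  loopless := by
    refine ⟨?_⟩
    rintro x (⟨i, j, h1, h2, -⟩ | ⟨i, j, h1, h2, -⟩) <;> subst h1 <;> simp at h2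

/-- The Kasteleyn–Wilson matrix entry at `(i,j)`: `0` if `{v i, w j}` is not an edge;
`1` if it is a horizontal edge; `(-1)^k` if it is a vertical edge joining `(a,l)` to
`(a,l+1)`, where `k` is the number of vertices of the graph with second coordinate `l`
and first coordinate strictly less than `a`. -/
noncomputable def kastEntry (N : ℕ) (v w : Fin N → ℤ × ℤ) (E : Fin N → Fin N → Prop)
    (i j : Fin N) : ℤ :=
  if E i j then
    if (v i).2 = (w j).2 then 1
    else (-1) ^ (Nat.card {u : Fin N ⊕ Fin N //
        (Sum.elim v w u).2 = min (v i).2 (w j).2 ∧ (Sum.elim v w u).1 < (v i).1})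
  else 0

/-- The number of perfect matchings of the induced subgraph of `G` on the vertex set `S`. -/
noncomputable def matchCount {V : Type*} (G : SimpleGraph V) (S : Set V) : ℕ :=
  Nat.card {M : G.Subgraph // M.verts = S ∧ M.IsMatching}

/-- The sign `-1` if `p` holds and `1` otherwise. -/
noncomputable def propSign (p : Prop) : ℤˣ := if p then -1 else 1

lemma propSign_mul (p q : Prop) : propSign p * propSign q = propSign (¬ (p ↔ q)) := by
  by_cases hp : p <;> by_cases hq : q <;> simp [propSign, hp, hq]

lemma propSign_congr {p q : Prop} (h : p ↔ q) : propSign p = propSign q := by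
  rw [propext h]

/-- Reading order on lattice points: row by row, from left to right. -/
def readsBefore (p q : ℤ × ℤ) : Prop := p.2 < q.2 ∨ (p.2 = q.2 ∧ p.1 < q.1)

/-- The sign `1` if `p` strictly precedes `q` in reading order and `-1` otherwise. -/
noncomputable def readSign (p q : ℤ × ℤ) : ℤˣ := propSign (¬ readsBefore p q)

/-- The contribution of the vertex `u` to the Kasteleyn–Wilson sign of the edge `pq`. -/
noncomputable def leftSign (p q u : ℤ × ℤ) : ℤˣ :=
  propSign (p.2 ≠ q.2 ∧ u.2 = min p.2 q.2 ∧ u.1 < p.1)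

/-- The sign `-1` if `pq` and `p'q'` are vertical edges, the second one a layer above the first. -/
noncomputable def layerSign (p q p' q' : ℤ × ℤ) : ℤˣ :=
  propSign (p.2 ≠ q.2 ∧ p'.2 ≠ q'.2 ∧ min p'.2 q'.2 = min p.2 q.2 + 1)

/-- `q` is the right or the upper neighbour of `p`. -/
def IsForwardStep (p q : ℤ × ℤ) : Prop :=
  (q.1 = p.1 + 1 ∧ q.2 = p.2) ∨ (q.1 = p.1 ∧ q.2 = p.2 + 1)

/-- The sign of the crossing of the chords `pq` and `p'q'` in reading order. -/
noncomputable def crossSign (p q p' q' : ℤ × ℤ) : ℤˣ :=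
  readSign p p' * readSign q q' * (readSign p q' * readSign q p')

lemma crossSign_swap_left (p q p' q' : ℤ × ℤ) : crossSign q p p' q' = crossSign p q p' q' := by
  simp only [crossSign]
  ac_rfl

lemma crossSign_swap_right (p q p' q' : ℤ × ℤ) : crossSign p q q' p' = crossSign p q p' q' := by
  simp only [crossSign]
  ac_rfl

lemma layerSign_swap_left (p q p' q' : ℤ × ℤ) : layerSign q p p' q' = layerSign p q p' q' := by
  simp only [layerSign, ne_comm (a := q.2), min_comm q.2]

lemma layerSign_swap_right (p q p' q' : ℤ × ℤ) : layerSign p q q' p' = layerSign p q p' q' := by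
  simp only [layerSign, ne_comm (a := q'.2), min_comm q'.2]

lemma latAdj.isForwardStep_or {p q : ℤ × ℤ} (h : latAdj p q) :
    IsForwardStep p q ∨ IsForwardStep q p := by
  unfold latAdj at h
  unfold IsForwardStep
  grind

lemma latAdj.leftSign_swap {p q : ℤ × ℤ} (h : latAdj p q) (u : ℤ × ℤ) :
    leftSign q p u = leftSign p q u := by
  apply propSign_congr
  unfold latAdj at h
  grind

lemma IsForwardStep.crossSign_eq {p q p' q' : ℤ × ℤ} (h : IsForwardStep p q)
    (h' : IsForwardStep p' q') (hpp : p ≠ p') (hpq : p ≠ q') (hqp : q ≠ p') (hqq : q ≠ q') :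
    leftSign p q p' * leftSign p q q' * layerSign p q p' q' *
      (leftSign p' q' p * leftSign p' q' q * layerSign p' q' p q) = crossSign p q p' q' := by
  obtain ⟨a, l⟩ := p
  obtain ⟨b, m⟩ := q
  obtain ⟨a', l'⟩ := p'
  obtain ⟨b', m'⟩ := q'
  simp only [IsForwardStep, ne_eq, Prod.mk.injEq] at *
  simp only [crossSign, leftSign, layerSign, readSign, readsBefore, propSign_mul]
  apply propSign_congr
  have hmin (x : ℤ) : min x (x + 1) = x := by omega
  obtain ⟨rfl, rfl⟩ | ⟨rfl, rfl⟩ := h <;> obtain ⟨rfl, rfl⟩ | ⟨rfl, rfl⟩ := h'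
  all_goals grind (splits := 20)

lemma latAdj.crossSign_eq {p q p' q' : ℤ × ℤ} (h : latAdj p q) (h' : latAdj p' q')
    (hpp : p ≠ p') (hpq : p ≠ q') (hqp : q ≠ p') (hqq : q ≠ q') :
    leftSign p q p' * leftSign p q q' * layerSign p q p' q' *
      (leftSign p' q' p * leftSign p' q' q * layerSign p' q' p q) = crossSign p q p' q' := by
  rcases h.isForwardStep_or with hf | hf <;> rcases h'.isForwardStep_or with hf' | hf'
  · exact hf.crossSign_eq hf' hpp hpq hqp hqq
  · have key := hf.crossSign_eq hf' hpq hpp hqq hqp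
    rw [crossSign_swap_right, h'.leftSign_swap p, h'.leftSign_swap q, layerSign_swap_left p' q',
      layerSign_swap_right p q] at key
    rw [← key, mul_comm (leftSign p q q')]
  · have key := hf.crossSign_eq hf' hqp hqq hpp hpq
    rw [crossSign_swap_left, h.leftSign_swap p', h.leftSign_swap q', layerSign_swap_left p q,
      layerSign_swap_right p' q'] at key
    rw [← key, mul_comm (leftSign p' q' q)]
  · have key := hf.crossSign_eq hf' hqq hqp hpq hpp
    rw [crossSign_swap_left, crossSign_swap_right, h.leftSign_swap p', h.leftSign_swap q',
      h'.leftSign_swap p, h'.leftSign_swap q, layerSign_swap_left p q, layerSign_swap_left p' q',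
      layerSign_swap_right p' q', layerSign_swap_right p q] at key
    rw [← key, mul_comm (leftSign p' q' q), mul_comm (leftSign p q q')]

lemma latAdj.layerSign_eq {p' q' : ℤ × ℤ} (h' : latAdj p' q') (p q : ℤ × ℤ) :
    layerSign p q p' q' = propSign (p.2 ≠ q.2 ∧ p'.2 ≤ min p.2 q.2 + 1) *
      propSign (p.2 ≠ q.2 ∧ q'.2 ≤ min p.2 q.2 + 1) := by
  rw [propSign_mul]
  apply propSign_congr
  unfold latAdj at h'
  grind

lemma latAdj.readSign_eq {p q : ℤ × ℤ} (h : latAdj p q) (hp : Even (p.1 + p.2))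
    (hq : Odd (q.1 + q.2)) :
    readSign p q = propSign (Odd ((p.1 + p.2) / 2)) * propSign (Odd ((q.1 + q.2) / 2)) := by
  rw [propSign_mul]
  apply propSign_congr
  unfold latAdj at h
  unfold readsBefore
  simp only [Int.odd_iff, Int.even_iff] at *
  grind

lemma leftSign_self_left (p q : ℤ × ℤ) : leftSign p q p = 1 := by
  simp [leftSign, propSign]

lemma latAdj.leftSign_self_right {p q : ℤ × ℤ} (h : latAdj p q) : leftSign p q q = 1 := by
  rw [← h.leftSign_swap, leftSign_self_left]

lemma layerSign_self (p q : ℤ × ℤ) : layerSign p q p q = 1 := by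
  simp [layerSign, propSign]

lemma readSign_swap {p q : ℤ × ℤ} (h : p ≠ q) : readSign q p = - readSign p q := by
  have h' : readsBefore q p ↔ ¬ readsBefore p q := by
    have := mt Prod.ext_iff.mpr h
    unfold readsBefore
    omega
  by_cases hpq : readsBefore p q <;> simp [readSign, propSign, h', hpq]

lemma exists_row_sign (f : ℤ → ℤˣ) : ∃ F : ℤ → ℤˣ, ∀ y, F y * F (y + 1) = f y := by
  refine ⟨fun y ↦ (∏ k ∈ Finset.range y.toNat, f k) *
    ∏ k ∈ Finset.range (-y).toNat, f (-1 - k), fun y ↦ ?_⟩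
  rcases le_or_gt 0 y with hy | hy
  · obtain ⟨n, rfl⟩ := Int.eq_ofNat_of_zero_le hy
    have h1 : (-(n : ℤ)).toNat = 0 := by omega
    have h2 : (-((n : ℤ) + 1)).toNat = 0 := by omega
    have h3 : ((n : ℤ) + 1).toNat = n + 1 := by omega
    simp only [h1, h2, h3, Int.toNat_natCast, Finset.prod_range_succ, Finset.range_zero,
      Finset.prod_empty, mul_one]
    rw [← mul_assoc, Int.units_mul_self, one_mul]
  · obtain ⟨n, rfl⟩ : ∃ n : ℕ, y = -1 - n := ⟨(-1 - y).toNat, by omega⟩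
    have h1 : (-1 - (n : ℤ)).toNat = 0 := by omega
    have h2 : (-1 - (n : ℤ) + 1).toNat = 0 := by omega
    have h3 : (-(-1 - (n : ℤ))).toNat = n + 1 := by omega
    have h4 : (-(-1 - (n : ℤ) + 1)).toNat = n := by omega
    simp only [h1, h2, h3, h4, Finset.prod_range_succ, Finset.range_zero, Finset.prod_empty,
      one_mul]
    rw [mul_right_comm, Int.units_mul_self, one_mul]

lemma prod_Ioi_comp_perm {N : ℕ} (σ : Equiv.Perm (Fin N)) {f : Fin N → Fin N → ℤˣ}
    (hf : ∀ i j, i ≠ j → f i j = - f j i) :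
    ∏ i, ∏ j ∈ Finset.Ioi i, f (σ i) (σ j) = σ.sign * ∏ i, ∏ j ∈ Finset.Ioi i, f i j := by
  have key := σ.prod_Ioi_comp_eq_sign_mul_prod
    (f := fun i j ↦ if i = j then (0 : ℤ) else f i j) (fun i j ↦ by
      by_cases hij : i = j
      · simp [hij]
      · simp [hij, Ne.symm hij, hf i j hij])
  have hoff (τ : Equiv.Perm (Fin N)) :
      ∏ i, ∏ j ∈ Finset.Ioi i, (if τ i = τ j then (0 : ℤ) else f (τ i) (τ j)) =
        ∏ i, ∏ j ∈ Finset.Ioi i, (f (τ i) (τ j) : ℤ) :=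
    Finset.prod_congr rfl fun i _ ↦ Finset.prod_congr rfl fun j hj ↦
      if_neg fun h ↦ (Finset.mem_Ioi.mp hj).ne (τ.injective h)
  rw [hoff σ, show (∏ i, ∏ j ∈ Finset.Ioi i, (if i = j then (0 : ℤ) else f i j)) = _ from
    hoff 1] at key
  ext
  simpa using key

lemma prod_prod_eq_prod_Ioi {N : ℕ} {M : Type*} [CommMonoid M] (f : Fin N → Fin N → M) :
    ∏ i, ∏ j, f i j = (∏ i, f i i) * ∏ i, ∏ j ∈ Finset.Ioi i, f i j * f j i := by
  rw [Finset.prod_prod_Ioi_mul_eq_prod_prod_off_diag (fun i j ↦ f j i), ← Finset.prod_mul_distrib]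
  exact Finset.prod_congr rfl fun i _ ↦ by rw [Fintype.prod_eq_mul_prod_compl i]

/-- The product of the crossing signs of a matching of points determines the sign of the
corresponding permutation. -/
lemma exists_prod_crossSign {N : ℕ} {v w : Fin N → ℤ × ℤ} (hvw : ∀ i j, v i ≠ w j)
    (hw : Function.Injective w) :
    ∃ C : ℤˣ, ∀ σ : Equiv.Perm (Fin N),
      ∏ i, ∏ j ∈ Finset.Ioi i, crossSign (v i) (w (σ i)) (v j) (w (σ j)) =
        C * σ.sign * ∏ i, readSign (v i) (w (σ i)) := by
  refine ⟨(∏ i, ∏ j ∈ Finset.Ioi i, readSign (v i) (v j)) *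
    (∏ i, ∏ j ∈ Finset.Ioi i, readSign (w i) (w j)) *
    (∏ i : Fin N, ∏ j ∈ Finset.Ioi i, -1) * ∏ i, ∏ j, readSign (v i) (w j), fun σ ↦ ?_⟩
  have hww := prod_Ioi_comp_perm σ (f := fun i j ↦ readSign (w i) (w j))
    fun i j hij ↦ readSign_swap (hw.ne hij.symm)
  have hmix : ∏ i, ∏ j, readSign (v i) (w j) = (∏ i, readSign (v i) (w (σ i))) *
      ∏ i, ∏ j ∈ Finset.Ioi i, readSign (v i) (w (σ j)) * readSign (v j) (w (σ i)) := by
    rw [← prod_prod_eq_prod_Ioi fun i j ↦ readSign (v i) (w (σ j))]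
    exact Finset.prod_congr rfl fun i _ ↦ (Equiv.prod_comp σ fun j ↦ readSign (v i) (w j)).symm
  have hneg : ∏ i, ∏ j ∈ Finset.Ioi i, readSign (v i) (w (σ j)) * readSign (w (σ i)) (v j) =
      (∏ i : Fin N, ∏ j ∈ Finset.Ioi i, -1) *
      ∏ i, ∏ j ∈ Finset.Ioi i, readSign (v i) (w (σ j)) * readSign (v j) (w (σ i)) := by
    simp_rw [← Finset.prod_mul_distrib, readSign_swap (hvw _ _), mul_neg, neg_mul, one_mul]
  have hsq : (∏ i, readSign (v i) (w (σ i))) * ∏ i, readSign (v i) (w (σ i)) = 1 :=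
    Int.units_mul_self _
  simp only [crossSign]
  simp_rw [Finset.prod_mul_distrib] at hww hmix hneg ⊢
  rw [hww, hneg, hmix]
  refine (mul_one _).symm.trans ?_
  rw [← hsq]
  ac_rfl

lemma kastEntry_eq_prod {N : ℕ} {v w : Fin N → ℤ × ℤ} {E : Fin N → Fin N → Prop} {i j : Fin N}
    (h : E i j) (σ : Equiv.Perm (Fin N)) :
    kastEntry N v w E i j =
      ((∏ k, leftSign (v i) (w j) (v k) * leftSign (v i) (w j) (w (σ k)) : ℤˣ) : ℤ) := by
  rw [Finset.prod_mul_distrib, Equiv.prod_comp σ fun k ↦ leftSign (v i) (w j) (w k),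
    kastEntry, if_pos h]
  split_ifs with hrow
  · simp [leftSign, propSign, hrow]
  · trans ((∏ u : Fin N ⊕ Fin N, leftSign (v i) (w j) (Sum.elim v w u) : ℤˣ) : ℤ)
    · simp only [leftSign, propSign, ne_eq, hrow, not_false_eq_true, true_and]
      rw [Finset.prod_ite, Nat.card_eq_fintype_card, Fintype.card_subtype]
      simp
    · rw [Fintype.prod_sum_type]
      rfl

lemma exists_prod_layerSign {N : ℕ} (v w : Fin N → ℤ × ℤ) :
    ∃ F : ℤ → ℤˣ, ∀ σ : Equiv.Perm (Fin N), (∀ i, latAdj (v i) (w (σ i))) → ∀ i,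
      ∏ j, layerSign (v i) (w (σ i)) (v j) (w (σ j)) = F (v i).2 * F (w (σ i)).2 := by
  obtain ⟨F, hF⟩ := exists_row_sign fun l ↦
    (∏ j, propSign ((v j).2 ≤ l + 1)) * ∏ j, propSign ((w j).2 ≤ l + 1)
  refine ⟨F, fun σ hσ i ↦ ?_⟩
  simp_rw [fun j ↦ (hσ j).layerSign_eq (v i) (w (σ i)), Finset.prod_mul_distrib]
  rw [Equiv.prod_comp σ fun j ↦
    propSign ((v i).2 ≠ (w (σ i)).2 ∧ (w j).2 ≤ min (v i).2 (w (σ i)).2 + 1)]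
  by_cases hrow : (v i).2 = (w (σ i)).2
  · simp [hrow, propSign, Int.units_mul_self]
  · simp only [ne_eq, hrow, not_false_eq_true, true_and]
    rw [← hF]
    have hcase : (w (σ i)).2 = (v i).2 + 1 ∨ (v i).2 = (w (σ i)).2 + 1 := by
      have := hσ i
      unfold latAdj at this
      grind
    rcases hcase with h | h <;> rw [h]
    · rw [min_eq_left (by omega)]
    · rw [min_eq_right (by omega), mul_comm]

/-- All perfect matchings contribute the same sign to the Kasteleyn–Wilson determinant. -/
lemma exists_sign_mul_prod_kastEntry {N : ℕ} {v w : Fin N → ℤ × ℤ} {E : Fin N → Fin N → Prop}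
    (hwhite : ∀ i, Even ((v i).1 + (v i).2)) (hblack : ∀ j, Odd ((w j).1 + (w j).2))
    (hv : Function.Injective v) (hw : Function.Injective w)
    (hE : ∀ i j, E i j → latAdj (v i) (w j)) :
    ∃ C : ℤˣ, ∀ σ : Equiv.Perm (Fin N), (∀ i, E i (σ i)) →
      (σ.sign : ℤ) * ∏ i, kastEntry N v w E i (σ i) = C := by
  have hvw (i j) : v i ≠ w j := fun h ↦
    Int.not_even_iff_odd.mpr (hblack j) (h ▸ hwhite i)
  obtain ⟨C, hC⟩ := exists_prod_crossSign hvw hw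
  obtain ⟨F, hF⟩ := exists_prod_layerSign v w
  refine ⟨C * ((∏ i, propSign (Odd (((v i).1 + (v i).2) / 2))) *
    ∏ j, propSign (Odd (((w j).1 + (w j).2) / 2))) *
    ((∏ i, F (v i).2) * ∏ j, F (w j).2), fun σ hσ ↦ ?_⟩
  have hadj (i) : latAdj (v i) (w (σ i)) := hE _ _ (hσ i)
  have hread : ∏ i, readSign (v i) (w (σ i)) =
      (∏ i, propSign (Odd (((v i).1 + (v i).2) / 2))) *
        ∏ j, propSign (Odd (((w j).1 + (w j).2) / 2)) := by
    rw [← Equiv.prod_comp σ fun j ↦ propSign (Odd (((w j).1 + (w j).2) / 2)),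
      ← Finset.prod_mul_distrib]
    exact Finset.prod_congr rfl fun i _ ↦ (hadj i).readSign_eq (hwhite i) (hblack _)
  have hlayer : ∏ i, ∏ j, layerSign (v i) (w (σ i)) (v j) (w (σ j)) =
      (∏ i, F (v i).2) * ∏ j, F (w j).2 := by
    rw [← Equiv.prod_comp σ fun j ↦ F (w j).2, ← Finset.prod_mul_distrib]
    exact Finset.prod_congr rfl fun i _ ↦ hF σ hadj i
  have hcross := prod_prod_eq_prod_Ioi fun i j ↦
    leftSign (v i) (w (σ i)) (v j) * leftSign (v i) (w (σ i)) (w (σ j)) *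
      layerSign (v i) (w (σ i)) (v j) (w (σ j))
  have hdiag : ∏ i, leftSign (v i) (w (σ i)) (v i) * leftSign (v i) (w (σ i)) (w (σ i)) *
      layerSign (v i) (w (σ i)) (v i) (w (σ i)) = 1 :=
    Finset.prod_eq_one fun i _ ↦ by
      rw [leftSign_self_left, (hadj i).leftSign_self_right, layerSign_self, one_mul, one_mul]
  have hoff : ∏ i, ∏ j ∈ Finset.Ioi i,
      (leftSign (v i) (w (σ i)) (v j) * leftSign (v i) (w (σ i)) (w (σ j)) *
        layerSign (v i) (w (σ i)) (v j) (w (σ j)) *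
      (leftSign (v j) (w (σ j)) (v i) * leftSign (v j) (w (σ j)) (w (σ i)) *
        layerSign (v j) (w (σ j)) (v i) (w (σ i)))) =
      ∏ i, ∏ j ∈ Finset.Ioi i, crossSign (v i) (w (σ i)) (v j) (w (σ j)) :=
    Finset.prod_congr rfl fun i _ ↦ Finset.prod_congr rfl fun j hj ↦ by
      have hij : i ≠ j := (Finset.mem_Ioi.mp hj).ne
      exact (hadj i).crossSign_eq (hadj j) (hv.ne hij) (hvw _ _) (hvw _ _).symm
        (hw.ne (σ.injective.ne hij))
  rw [hdiag, hoff, one_mul, hC, hread] at hcross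
  simp_rw [Finset.prod_mul_distrib (g := fun j ↦ layerSign _ _ (v j) (w (σ j)))] at hcross
  rw [Finset.prod_mul_distrib, hlayer, ← eq_mul_inv_iff_mul_eq, Int.units_inv_eq_self] at hcross
  simp_rw [fun i ↦ kastEntry_eq_prod (v := v) (w := w) (hσ i) σ]
  rw [← Units.coe_prod, ← Units.val_mul, hcross]
  congr 1
  simp only [← mul_assoc, mul_comm σ.sign C]
  simp only [mul_assoc]
  rw [← mul_assoc σ.sign, Int.units_mul_self, one_mul]

/-- The perfect matching of `latGraph N E` given by a permutation along edges. -/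
def permMatching {N : ℕ} {E : Fin N → Fin N → Prop} (σ : Equiv.Perm (Fin N))
    (h : ∀ i, E i (σ i)) : (latGraph N E).Subgraph where
  verts := Set.univ
  Adj x y := (∃ i, x = Sum.inl i ∧ y = Sum.inr (σ i)) ∨ ∃ i, x = Sum.inr (σ i) ∧ y = Sum.inl i
  adj_sub := by
    rintro x y (⟨i, rfl, rfl⟩ | ⟨i, rfl, rfl⟩)
    · exact Or.inl ⟨i, σ i, rfl, rfl, h i⟩
    · exact Or.inr ⟨i, σ i, rfl, rfl, h i⟩
  edge_vert _ := Set.mem_univ _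
  symm := by
    refine ⟨?_⟩
    rintro x y (⟨i, rfl, rfl⟩ | ⟨i, rfl, rfl⟩)
    · exact Or.inr ⟨i, rfl, rfl⟩
    · exact Or.inl ⟨i, rfl, rfl⟩

lemma permMatching_isMatching {N : ℕ} {E : Fin N → Fin N → Prop} (σ : Equiv.Perm (Fin N))
    (h : ∀ i, E i (σ i)) : (permMatching σ h).IsMatching := by
  rintro (i | j) -
  · refine ⟨Sum.inr (σ i), Or.inl ⟨i, rfl, rfl⟩, ?_⟩
    rintro y (⟨k, hk, rfl⟩ | ⟨k, hk, rfl⟩)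
    · rw [Sum.inl.inj hk]
    · simp at hk
  · refine ⟨Sum.inl (σ.symm j), Or.inr ⟨σ.symm j, by simp, rfl⟩, ?_⟩
    rintro y (⟨k, hk, rfl⟩ | ⟨k, hk, rfl⟩)
    · simp at hk
    · simp [Sum.inr.inj hk]

lemma exists_permMatching_eq {N : ℕ} {E : Fin N → Fin N → Prop} {M : (latGraph N E).Subgraph}
    (hverts : M.verts = Set.univ) (hM : M.IsMatching) :
    ∃ (σ : Equiv.Perm (Fin N)) (h : ∀ i, E i (σ i)), permMatching σ h = M := by
  have hmem (x) : x ∈ M.verts := hverts ▸ Set.mem_univ x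
  have hex (i : Fin N) : ∃ j, M.Adj (Sum.inl i) (Sum.inr j) := by
    obtain ⟨y, hy, -⟩ := hM (hmem (Sum.inl i))
    rcases M.adj_sub hy with ⟨_, j, -, rfl, -⟩ | ⟨_, _, h, -, -⟩
    · exact ⟨j, hy⟩
    · simp at h
  choose f hf using hex
  have hinj : Function.Injective f := fun i k hik ↦
    Sum.inl.inj ((hM (hmem (Sum.inr (f i)))).unique (hf i).symm (hik ▸ (hf k).symm))
  have hedge (i) : E i (f i) := by
    rcases M.adj_sub (hf i) with ⟨a, b, ha, hb, h⟩ | ⟨_, _, h, -, -⟩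
    · rwa [Sum.inl.inj ha, ← Sum.inr.inj hb, ← Sum.inl.inj ha] at *
    · simp at h
  have huniq {i j} (h : M.Adj (Sum.inl i) (Sum.inr j)) : j = f i :=
    Sum.inr.inj ((hM (hmem (Sum.inl i))).unique h (hf i))
  refine ⟨Equiv.ofBijective f (Finite.injective_iff_bijective.mp hinj), hedge, ?_⟩
  refine SimpleGraph.Subgraph.ext hverts.symm (funext₂ fun x y ↦ propext ⟨?_, fun h ↦ ?_⟩)
  · rintro (⟨i, rfl, rfl⟩ | ⟨i, rfl, rfl⟩)
    · exact hf i
    · exact (hf i).symm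
  · rcases M.adj_sub h with ⟨i, j, rfl, rfl, -⟩ | ⟨i, j, rfl, rfl, -⟩
    · exact Or.inl ⟨i, rfl, congrArg _ (huniq h)⟩
    · exact Or.inr ⟨i, congrArg _ (huniq h.symm), rfl⟩

lemma matchCount_latGraph {N : ℕ} (E : Fin N → Fin N → Prop) :
    matchCount (latGraph N E) Set.univ =
      (Finset.univ.filter fun σ : Equiv.Perm (Fin N) ↦ ∀ i, E i (σ i)).card := by
  rw [matchCount, ← Fintype.card_subtype, ← Nat.card_eq_fintype_card]
  symm
  refine Nat.card_congr (Equiv.ofBijective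
    (fun σ ↦ ⟨permMatching σ.1 σ.2, rfl, permMatching_isMatching σ.1 σ.2⟩) ⟨?_, ?_⟩)
  · rintro ⟨σ, hσ⟩ ⟨τ, hτ⟩ h
    refine Subtype.ext (Equiv.ext fun i ↦ ?_)
    have hadj : (permMatching τ hτ).Adj (Sum.inl i) (Sum.inr (σ i)) := by
      rw [← show permMatching σ hσ = permMatching τ hτ from congrArg Subtype.val h]
      exact Or.inl ⟨i, rfl, rfl⟩
    rcases hadj with ⟨k, hk, hk'⟩ | ⟨k, hk, -⟩
    · obtain rfl := Sum.inl.inj hk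
      exact Sum.inr.inj hk'
    · simp at hk
  · rintro ⟨M, hverts, hM⟩
    obtain ⟨σ, h, rfl⟩ := exists_permMatching_eq hverts hM
    exact ⟨⟨σ, h⟩, rfl⟩

/-- The number of perfect matchings of a finite subgraph `G` of the square lattice, with white
vertices `v 1, …, v N` and black vertices `w 1, …, w N`, equals the absolute value of the
determinant of its Kasteleyn–Wilson matrix. -/
theorem kasteleyn_wilson_count (N : ℕ) (v w : Fin N → ℤ × ℤ) (E : Fin N → Fin N → Prop)
    (hwhite : ∀ i, Even ((v i).1 + (v i).2)) (hblack : ∀ j, Odd ((w j).1 + (w j).2))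
    (hv : Function.Injective v) (hw : Function.Injective w)
    (hE : ∀ i j, E i j → latAdj (v i) (w j)) :
    (matchCount (latGraph N E) Set.univ : ℤ)
      = |(Matrix.of (kastEntry N v w E)).det| := by
  obtain ⟨C, hC⟩ := exists_sign_mul_prod_kastEntry hwhite hblack hv hw hE
  have hdet : (Matrix.of (kastEntry N v w E)).det =
      C * (matchCount (latGraph N E) Set.univ : ℤ) := by
    rw [matchCount_latGraph, ← Matrix.det_transpose, Matrix.det_apply', Finset.card_filter,
      Nat.cast_sum, Finset.mul_sum]
    refine Finset.sum_congr rfl fun σ _ ↦ ?_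
    split_ifs with h
    · simpa using hC σ h
    · obtain ⟨i, hi⟩ := not_forall.mp h
      simp [Finset.prod_eq_zero (Finset.mem_univ i), kastEntry, hi]
  rw [hdet, abs_mul, Int.isUnit_iff_abs_eq.mp C.isUnit, one_mul, Nat.abs_cast]
end

section
/- (EKLP Lemma, first part.) For all integers n ≥ 1, 1 ≤ m ≤ n+1 and 1 ≤ x_1 < x_2 < ... < x_m ≤ n+1, the number of perfect matchings of the n×m black-edged Aztec rectangle with dents at x_1,...,x_m equals 2^{m(m-1)/2} · (∏_{1 ≤ i < j ≤ m} (x_j - x_i)) / (∏_{k=1}^{m-1} k!). -/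
open scoped Classical

/-- Adjacency between the coordinates of a white vertex `p` and a black vertex `q` in the
(tilted) square grid: the black vertex `(i',j')` is adjacent to the white vertex `(i,j)`
iff `i' ∈ {i, i+1}` and `j' ∈ {j-1, j}`. -/
def adjC (p q : ℕ × ℕ) : Prop :=
  (q.1 = p.1 ∨ q.1 = p.1 + 1) ∧ (q.2 + 1 = p.2 ∨ q.2 = p.2)

/-- The bipartite grid graph on `Bool × ℕ × ℕ`: `(false, p)` is a white vertex with
coordinates `p`, `(true, q)` is a black vertex with coordinates `q`. -/
def coloredGrid : SimpleGraph (Bool × ℕ × ℕ) where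
  Adj u v := (u.1 = false ∧ v.1 = true ∧ adjC u.2 v.2) ∨
             (v.1 = false ∧ u.1 = true ∧ adjC v.2 u.2)
  symm := ⟨by intro u v h; tauto⟩
  loopless := ⟨by intro u h; rcases h with ⟨h1, h2, -⟩ | ⟨h1, h2, -⟩ <;> simp [h1] at h2⟩

/-- Vertex set of the `n × m` black-edged Aztec rectangle with the given set of dents:
white vertices `(i,j)` with `1 ≤ i ≤ n`, `1 ≤ j ≤ m`; black vertices `(i,j)` with
`1 ≤ i ≤ n+1`, `1 ≤ j ≤ m-1`, together with the black vertices `(i,m)`, `1 ≤ i ≤ n+1`,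
for `i` not a dent. -/
def blackRectVerts (n m : ℕ) (dents : Set ℕ) : Set (Bool × ℕ × ℕ) :=
  {v | (v.1 = false ∧ 1 ≤ v.2.1 ∧ v.2.1 ≤ n ∧ 1 ≤ v.2.2 ∧ v.2.2 ≤ m) ∨
       (v.1 = true ∧ 1 ≤ v.2.1 ∧ v.2.1 ≤ n + 1 ∧
         ((1 ≤ v.2.2 ∧ v.2.2 ≤ m - 1) ∨ (v.2.2 = m ∧ v.2.1 ∉ dents)))}

/-- Vertex set of the `n × m` white-edged Aztec rectangle with the given set of teeth:
white vertices `(i,j)` with `1 ≤ i ≤ n`, `1 ≤ j ≤ m`, together with the white vertices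
`(i, m+1)` for `i` a tooth; black vertices `(i,j)` with `1 ≤ i ≤ n+1`, `1 ≤ j ≤ m`. -/
def whiteRectVerts (n m : ℕ) (teeth : Set ℕ) : Set (Bool × ℕ × ℕ) :=
  {v | (v.1 = false ∧ ((1 ≤ v.2.1 ∧ v.2.1 ≤ n ∧ 1 ≤ v.2.2 ∧ v.2.2 ≤ m) ∨
         (v.2.2 = m + 1 ∧ v.2.1 ∈ teeth))) ∨
       (v.1 = true ∧ 1 ≤ v.2.1 ∧ v.2.1 ≤ n + 1 ∧ 1 ≤ v.2.2 ∧ v.2.2 ≤ m)}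

/-- The matrix of binomial coefficients `C(x i, j)`. -/
def chooseMatrix {m : ℕ} (x : Fin m → ℕ) : Matrix (Fin m) (Fin m) ℚ :=
  Matrix.of fun i j => ((x i).choose j : ℚ)

theorem det_chooseMatrix {m : ℕ} (x : Fin m → ℕ) :
    (chooseMatrix x).det =
      (∏ p ∈ Finset.univ.filter (fun p : Fin m × Fin m => p.1 < p.2),
        ((x p.2 : ℚ) - (x p.1 : ℚ))) / ∏ k ∈ Finset.Icc 1 (m - 1), (k.factorial : ℚ) := by
  have hfac : (∏ k ∈ Finset.Icc 1 (m - 1), (k.factorial : ℚ)) =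
      ∏ j : Fin m, ((j : ℕ).factorial : ℚ) := by
    rw [Fin.prod_univ_eq_prod_range (fun k => (k.factorial : ℚ))]
    clear x
    cases m with
    | zero => simp
    | succ m =>
      induction m with
      | zero => simp
      | succ m ih =>
        rw [Finset.prod_range_succ, ← ih]
        exact Finset.prod_Icc_succ_top (by omega) _
  have hV : (∏ p ∈ Finset.univ.filter (fun p : Fin m × Fin m => p.1 < p.2),
        ((x p.2 : ℚ) - (x p.1 : ℚ))) = (Matrix.vandermonde fun i => (x i : ℚ)).det := by
    rw [Matrix.det_vandermonde, Finset.prod_filter, ← Finset.univ_product_univ,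
      Finset.prod_product]
    refine Finset.prod_congr rfl fun i _ => ?_
    rw [← Finset.prod_filter]
    congr 1
    ext j
    simp
  rw [hfac, hV, eq_div_iff (Finset.prod_ne_zero_iff.2 fun j _ => by positivity),
    Matrix.det_eval_matrixOfPolynomials_eq_det_vandermonde _
      (fun j : Fin m => descPochhammer ℚ j) (fun j => descPochhammer_natDegree ℚ j)
      (fun j => monic_descPochhammer ℚ j), mul_comm, ← Matrix.det_mul_row]
  congr 1
  ext i j
  simp [chooseMatrix, descPochhammer_eval_eq_descFactorial, Nat.descFactorial_eq_factorial_mul_choose]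

theorem det_chooseMatrix_succ {m : ℕ} (b : Fin (m + 1) → ℕ) :
    (chooseMatrix b).det = (Matrix.of fun i j : Fin m =>
      (((b i.succ).choose (j + 1) : ℚ) - (b i.castSucc).choose (j + 1))).det := by
  rw [Matrix.det_eq_of_forall_row_eq_smul_add_pred (A := chooseMatrix b)
    (B := Matrix.of (Fin.cons (chooseMatrix b 0)
      fun i j => chooseMatrix b i.succ j - chooseMatrix b i.castSucc j)) (fun _ => 1),
    Matrix.det_succ_column_zero, Fin.sum_univ_succ]
  · simp [chooseMatrix, Matrix.submatrix]
  · simp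
  · simp

theorem two_pow_mul_det_chooseMatrix {m : ℕ} (b : Fin (m + 1) → ℕ) :
    2 ^ m * (chooseMatrix b).det = (Matrix.of fun i j : Fin m =>
      ((2 * (b i.succ).choose (j + 1) + (b i.succ).choose j : ℚ) -
        (2 * (b i.castSucc).choose (j + 1) + (b i.castSucc).choose j))).det := by
  rw [det_chooseMatrix_succ]
  cases m with
  | zero => simp
  | succ m =>
    have h := Matrix.det_smul (Matrix.of fun i j : Fin (m + 1) =>
      (((b i.succ).choose (j + 1) : ℚ) - (b i.castSucc).choose (j + 1))) 2
    rw [Fintype.card_fin] at h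
    rw [← h]
    apply Matrix.det_eq_of_forall_col_eq_smul_add_pred (fun _ => -1 / 2)
    · intro i
      simp
      ring
    · intro i j
      simp
      ring

theorem sum_trapezoid_choose (p q j : ℕ) (h : p ≤ q) :
    ∑ a ∈ Finset.Icc p q, (((if p < a then 1 else 0) + if a < q then 1 else 0 : ℚ)) * a.choose j
      = (2 * q.choose (j + 1) + q.choose j) - (2 * p.choose (j + 1) + p.choose j) := by
  simp_rw [add_mul, Finset.sum_add_distrib, ite_mul, one_mul, zero_mul, ← Finset.sum_filter]
  have h1 : (Finset.Icc p q).filter (fun a => p < a) = Finset.Ico (p + 1) (q + 1) := by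
    ext; simp; omega
  have h2 : (Finset.Icc p q).filter (fun a => a < q) = Finset.Ico p q := by
    ext; simp; omega
  rw [h1, h2]
  induction q, h using Nat.le_induction with
  | base => simp
  | succ q hq ih =>
    rw [Finset.sum_Ico_succ_top (by omega), Finset.sum_Ico_succ_top hq]
    have := ih (by ext; simp; omega) (by ext; simp; omega)
    have h3 : ((q + 1).choose (j + 1) : ℚ) = q.choose j + q.choose (j + 1) := by
      exact_mod_cast Nat.choose_succ_succ q j
    rw [h3]
    linarith

/-- Multilinear expansion of the determinant along trapezoidal sums. -/
theorem two_pow_mul_det_chooseMatrix_eq_sum {m : ℕ} (b : Fin (m + 1) → ℕ) (hb : Monotone b) :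
    2 ^ m * (chooseMatrix b).det =
      ∑ a ∈ Fintype.piFinset fun i : Fin m => Finset.Icc (b i.castSucc) (b i.succ),
        (∏ i, ((if b i.castSucc < a i then 1 else 0) + if a i < b i.succ then 1 else 0 : ℚ)) *
          (chooseMatrix a).det := by
  rw [two_pow_mul_det_chooseMatrix]
  simp_rw [← sum_trapezoid_choose _ _ _ (hb (Fin.castSucc_lt_succ (i := _)).le)]
  have h := (Matrix.detRowAlternating (n := Fin m) (R := ℚ)).toMultilinearMap.map_sum_finset
    (fun (i : Fin m) (a : ℕ) (j : Fin m) =>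
      (((if b i.castSucc < a then 1 else 0) + if a < b i.succ then 1 else 0 : ℚ)) * a.choose j)
    (fun i : Fin m => Finset.Icc (b i.castSucc) (b i.succ))
  refine Eq.trans ?_ (h.trans ?_)
  · change Matrix.det _ = Matrix.det _
    congr 1
    ext i j
    simp [Finset.sum_apply]
  · refine Finset.sum_congr rfl fun a _ => ?_
    exact Matrix.det_mul_column _ (chooseMatrix a)

/-- Bijections from `W` onto `K` along the relation `r`, normalized to be the identity off `W`. -/
def relMatchings {α : Type*} (r : α → α → Prop) (W K : Finset α) : Set (α → α) :=
  {f | Set.BijOn f W K ∧ (∀ p ∈ W, r p (f p)) ∧ ∀ p ∉ W, f p = p}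

theorem finite_relMatchings {α : Type*} (r : α → α → Prop) (W K : Finset α) :
    (relMatchings r W K).Finite := by
  have : Finite (relMatchings r W K) := by
    refine Finite.of_injective
      (fun (f : relMatchings r W K) (p : W) => (⟨f.1 p, f.2.1.mapsTo p.2⟩ : K)) ?_
    intro f g h
    ext p
    by_cases hp : p ∈ W
    · exact congrArg Subtype.val (congrFun h ⟨p, hp⟩)
    · rw [f.2.2.2 p hp, g.2.2.2 p hp]
  exact Set.toFinite _

/-- The number of perfect matchings of the bipartite graph with parts `W`, `K` and relation `r`. -/
noncomputable def relMatchCount {α : Type*} (r : α → α → Prop) (W K : Finset α) : ℕ :=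
  Nat.card (relMatchings r W K)

theorem relMatchCount_eq_zero {α : Type*} {r : α → α → Prop} {W K : Finset α}
    (h : ∀ f, f ∉ relMatchings r W K) : relMatchCount r W K = 0 := by
  have : IsEmpty (relMatchings r W K) := ⟨fun f => h f.1 f.2⟩
  exact Nat.card_of_isEmpty

theorem relMatchCount_union {α : Type*} [DecidableEq α] (r : α → α → Prop) {W₁ W₂ K : Finset α}
    (hW : Disjoint W₁ W₂) :
    relMatchCount r (W₁ ∪ W₂) K =
      ∑ L ∈ K.powerset, relMatchCount r W₁ L * relMatchCount r W₂ (K \ L) := by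
  have hfin (W K : Finset α) : Finite (relMatchings r W K) := finite_relMatchings r W K
  have hdis : ∀ p ∈ W₁, p ∉ W₂ := fun p hp => Finset.disjoint_left.1 hW hp
  rw [← Finset.sum_coe_sort]
  simp_rw [relMatchCount, ← Nat.card_prod]
  rw [← Nat.card_sigma]
  symm
  let F : (Σ L : K.powerset, relMatchings r W₁ L × relMatchings r W₂ (K \ L)) →
      relMatchings r (W₁ ∪ W₂) K := fun x => ⟨fun p => if p ∈ W₁ then x.2.1.1 p else x.2.2.1 p, by
    obtain ⟨⟨L, hL⟩, ⟨f, hf, hfr, hfi⟩, ⟨g, hg, hgr, hgi⟩⟩ := x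
    rw [Finset.mem_powerset] at hL
    simp only at hf hg ⊢
    have e1 : Set.EqOn (fun p => if p ∈ W₁ then f p else g p) f W₁ := fun p hp => if_pos hp
    have e2 : Set.EqOn (fun p => if p ∈ W₁ then f p else g p) g W₂ :=
      fun p hp => if_neg fun h => hdis p h hp
    refine ⟨?_, ?_, ?_⟩
    · have h := (hf.congr e1.symm).union (hg.congr e2.symm) ?_
      · have hLK : (L : Set α) ∪ ((K \ L : Finset α) : Set α) = K := by
          rw [← Finset.coe_union, Finset.union_sdiff_of_subset hL]
        rwa [hLK, ← Finset.coe_union] at h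
      · rw [Set.injOn_union (Set.disjoint_left.2 hdis)]
        refine ⟨(hf.congr e1.symm).injOn, (hg.congr e2.symm).injOn, fun p hp q hq => ?_⟩
        intro h
        replace h : f p = g q := (e1 hp).symm.trans (h.trans (e2 hq))
        have h1 := hf.mapsTo hp
        have h2 := hg.mapsTo hq
        rw [h] at h1
        simp at h1 h2
        exact h2.2 h1
    · intro p hp
      by_cases h : p ∈ W₁
      · simpa [h] using hfr p h
      · simpa [h] using hgr p (by simpa [h] using hp)
    · intro p hp
      simp only [Finset.mem_union, not_or] at hp
      simpa [hp.1] using hgi p hp.2⟩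
  refine Nat.card_eq_of_bijective F ⟨?_, ?_⟩
  · rintro ⟨⟨L, hL⟩, ⟨f, hf⟩, ⟨g, hg⟩⟩ ⟨⟨L', hL'⟩, ⟨f', hf'⟩, ⟨g', hg'⟩⟩ h
    have h' : ∀ p, (if p ∈ W₁ then f p else g p) = if p ∈ W₁ then f' p else g' p :=
      fun p => congrFun (congrArg Subtype.val h) p
    have e1 : f = f' := by
      funext p
      by_cases hp : p ∈ W₁
      · simpa [hp] using h' p
      · rw [hf.2.2 p hp, hf'.2.2 p hp]
    have e2 : g = g' := by
      funext p
      by_cases hp : p ∈ W₂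
      · have hp1 : p ∉ W₁ := fun h => hdis p h hp
        simpa [hp1] using h' p
      · rw [hg.2.2 p hp, hg'.2.2 p hp]
    subst e1 e2
    have e3 : L = L' := by
      have := hf.1.image_eq.symm.trans hf'.1.image_eq
      exact Finset.coe_injective this
    subst e3
    rfl
  · rintro ⟨f, hf, hfr, hfi⟩
    have hsub : W₁.image f ⊆ K := by
      intro q hq
      obtain ⟨p, hp, rfl⟩ := Finset.mem_image.1 hq
      exact hf.mapsTo (by simp [hp])
    have hi : ∀ p ∈ W₁ ∪ W₂, ∀ q ∈ W₁ ∪ W₂, f p = f q → p = q := fun p hp q hq h =>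
      hf.injOn hp hq h
    refine ⟨⟨⟨W₁.image f, Finset.mem_powerset.2 hsub⟩,
      ⟨fun p => if p ∈ W₁ then f p else p, ?_, ?_, ?_⟩,
      ⟨fun p => if p ∈ W₂ then f p else p, ?_, ?_, ?_⟩⟩, ?_⟩
    · refine Set.BijOn.congr (f₁ := f) ?_ fun p hp => (if_pos hp).symm
      rw [Finset.coe_image]
      exact Set.InjOn.bijOn_image fun p hp q hq h =>
        hi p (Finset.mem_union_left _ hp) q (Finset.mem_union_left _ hq) h
    · intro p hp
      simpa [hp] using hfr p (Finset.mem_union_left _ hp)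
    · intro p hp
      simp [hp]
    · refine Set.BijOn.congr (f₁ := f) ?_ fun p hp => (if_pos hp).symm
      refine ⟨?_, ?_, ?_⟩
      · intro p hp
        have h1 := hf.mapsTo (x := p) (Finset.mem_union_right _ hp)
        simp only [Finset.coe_sdiff, Set.mem_sdiff, Finset.mem_coe, Finset.mem_image, not_exists, not_and]
        refine ⟨h1, fun q hq h => ?_⟩
        have := hi q (Finset.mem_union_left _ hq) p (Finset.mem_union_right _ hp) h
        exact hdis q hq (this ▸ hp)
      · exact fun p hp q hq h =>
          hi p (Finset.mem_union_right _ hp) q (Finset.mem_union_right _ hq) h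
      · intro q hq
        simp only [Finset.coe_sdiff, Set.mem_sdiff, Finset.mem_coe, Finset.mem_image, not_exists, not_and] at hq
        obtain ⟨p, hp, rfl⟩ := hf.surjOn hq.1
        rcases Finset.mem_union.1 hp with h | h
        · exact absurd rfl (hq.2 p h)
        · exact ⟨p, h, rfl⟩
    · intro p hp
      simpa [hp] using hfr p (Finset.mem_union_right _ hp)
    · intro p hp
      simp [hp]
    · ext1
      funext p
      by_cases h1 : p ∈ W₁
      · simp [F, h1]
      · by_cases h2 : p ∈ W₂
        · simp [F, h1, h2]
        · simp [F, h1, h2, hfi p]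

/-- The number of elements of `A` that are at most `i`. -/
def countLE (A : Finset ℕ) (i : ℕ) : ℕ := (A.filter (· ≤ i)).card

theorem countLE_succ (A : Finset ℕ) (i : ℕ) :
    countLE A (i + 1) = countLE A i + if i + 1 ∈ A then 1 else 0 := by
  have h : A.filter (· ≤ i + 1) = A.filter (· ≤ i) ∪ (if i + 1 ∈ A then {i + 1} else ∅) := by
    ext a
    split_ifs <;> grind
  rw [countLE, h, Finset.card_union_of_disjoint, ← countLE]
  · split_ifs <;> simp
  · rw [Finset.disjoint_left]
    intro a ha
    split_ifs <;> grind

theorem countLE_zero {A : Finset ℕ} {n : ℕ} (hA : A ⊆ Finset.Icc 1 n) : countLE A 0 = 0 := by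
  rw [countLE, Finset.card_eq_zero, Finset.filter_eq_empty_iff]
  intro a ha
  have := Finset.mem_Icc.1 (hA ha)
  omega

/-- The condition that `A` interlaces `B` inside `{1, …, n + 1}`, in terms of counting functions. -/
def Interlace (n : ℕ) (A B : Finset ℕ) : Prop :=
  (∀ i ≤ n, countLE A i ≤ countLE B i ∧ countLE B i ≤ countLE A i + 1) ∧
    countLE B (n + 1) = countLE A (n + 1) + 1

/-- The white vertices in column `c`. -/
def whiteCol (n c : ℕ) : Finset (ℕ × ℕ) := Finset.Icc 1 n ×ˢ {c}

/-- The black vertices at heights in `A` in column `c`, and those at heights outside `B` in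
column `c + 1`. -/
def blackStrip (n c : ℕ) (A B : Finset ℕ) : Finset (ℕ × ℕ) :=
  A ×ˢ {c} ∪ (Finset.Icc 1 (n + 1) \ B) ×ˢ {c + 1}

theorem strip_matching_local {n c : ℕ} {A B : Finset ℕ} {f : ℕ × ℕ → ℕ × ℕ}
    (hf : f ∈ relMatchings adjC (whiteCol n (c + 1)) (blackStrip n c A B)) :
    (∀ i, 1 ≤ i → i ≤ n → (f (i, c + 1) = (i, c) ∧ i ∈ A) ∨ (f (i, c + 1) = (i + 1, c) ∧ i + 1 ∈ A) ∨
      (f (i, c + 1) = (i, c + 1) ∧ i ∉ B) ∨ (f (i, c + 1) = (i + 1, c + 1) ∧ i + 1 ∉ B)) ∧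
    (∀ i, 1 ≤ i → i + 1 ≤ n → f (i, c + 1) ≠ f (i + 1, c + 1)) ∧
    (∀ v ∈ A, (v ≤ n ∧ f (v, c + 1) = (v, c)) ∨ (2 ≤ v ∧ f (v - 1, c + 1) = (v, c))) ∧
    (∀ v, 1 ≤ v → v ≤ n + 1 → v ∉ B →
      (v ≤ n ∧ f (v, c + 1) = (v, c + 1)) ∨ (2 ≤ v ∧ f (v - 1, c + 1) = (v, c + 1))) := by
  obtain ⟨hbij, hr, -⟩ := hf
  have hmem : ∀ i, 1 ≤ i → i ≤ n → (i, c + 1) ∈ whiteCol n (c + 1) := by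
    intro i h1 h2
    simp [whiteCol, h1, h2]
  have hsurj : ∀ q ∈ blackStrip n c A B, ∃ i, 1 ≤ i ∧ i ≤ n ∧ f (i, c + 1) = q ∧
      (q.1 = i ∨ q.1 = i + 1) := by
    intro q hq
    obtain ⟨⟨i, j⟩, hp, rfl⟩ := hbij.surjOn hq
    have hadj := hr _ hp
    simp only [whiteCol, Finset.coe_product, Set.mem_prod, Finset.mem_coe, Finset.mem_Icc,
      Finset.mem_singleton] at hp
    obtain ⟨⟨h1, h2⟩, rfl⟩ := hp
    exact ⟨i, h1, h2, rfl, hadj.1⟩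
  refine ⟨?_, ?_, ?_, ?_⟩
  · intro i h1 h2
    have hadj := hr _ (hmem i h1 h2)
    have hm := hbij.mapsTo (hmem i h1 h2)
    obtain ⟨⟨v, k⟩, hv⟩ : ∃ q, f (i, c + 1) = q := ⟨_, rfl⟩
    rw [hv] at hadj hm
    simp only [adjC, blackStrip, Finset.coe_union, Set.mem_union, Finset.mem_coe,
      Finset.mem_product, Finset.mem_sdiff, Finset.mem_singleton] at hadj hm
    grind
  · intro i h1 h2 h
    have := hbij.injOn (hmem i h1 (by omega)) (hmem (i + 1) (by omega) h2) h
    simp at this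
  · intro v hv
    obtain ⟨i, h1, h2, h3, h4⟩ := hsurj (v, c) (by simp [blackStrip, hv])
    simp only at h4
    rcases h4 with rfl | rfl
    · exact Or.inl ⟨h2, h3⟩
    · exact Or.inr ⟨by omega, h3⟩
  · intro v hv hv' hB
    obtain ⟨i, h1, h2, h3, h4⟩ := hsurj (v, c + 1) (by simp [blackStrip, hv, hv', hB])
    simp only at h4
    rcases h4 with rfl | rfl
    · exact Or.inl ⟨h2, h3⟩
    · exact Or.inr ⟨by omega, h3⟩

theorem countLE_of_strip_matching {n c : ℕ} {A B : Finset ℕ} (hA : A ⊆ Finset.Icc 1 (n + 1))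
    (hB : B ⊆ Finset.Icc 1 (n + 1)) {f : ℕ × ℕ → ℕ × ℕ}
    (hf : f ∈ relMatchings adjC (whiteCol n (c + 1)) (blackStrip n c A B)) :
    (∀ i, 1 ≤ i → i ≤ n → countLE A i + (f (i, c + 1)).1 = countLE B i + i) ∧
      countLE B (n + 1) = countLE A (n + 1) + 1 := by
  obtain ⟨hmap, hinj, hsA, hsB⟩ := strip_matching_local hf
  have hA0 := countLE_zero hA
  have hB0 := countLE_zero hB
  have key : ∀ i, i ≤ n → (1 ≤ i → countLE A i + (f (i, c + 1)).1 = countLE B i + i) := by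
    intro i
    induction i with
    | zero => intro _ h; omega
    | succ i ih =>
      intro h1 h2
      have ih' := ih (by omega)
      rw [countLE_succ, countLE_succ]
      have m1 := hmap (i + 1) h2 h1
      have m2 := hmap i
      have m3 := hinj i
      have sA := hsA (i + 1)
      have sB := hsB (i + 1) h2 (by omega)
      simp only [Nat.add_sub_cancel] at sA sB
      clear ih hmap hinj hsA hsB
      rcases Nat.eq_zero_or_pos i with rfl | hi
      · clear ih' m2 m3
        rcases m1 with ⟨m1, _⟩ | ⟨m1, _⟩ | ⟨m1, _⟩ | ⟨m1, _⟩ <;> rw [m1] at sA sB ⊢ <;> grind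
      · specialize m2 hi (by omega)
        specialize m3 hi h1
        specialize ih' hi
        generalize f (i, c + 1) = u at *
        generalize f (i + 1, c + 1) = w at *
        rcases m1 with ⟨rfl, _⟩ | ⟨rfl, _⟩ | ⟨rfl, _⟩ | ⟨rfl, _⟩ <;>
        rcases m2 with ⟨rfl, _⟩ | ⟨rfl, _⟩ | ⟨rfl, _⟩ | ⟨rfl, _⟩ <;> grind
  refine ⟨fun i h1 h2 => key i h2 h1, ?_⟩
  rw [countLE_succ, countLE_succ]
  have ih' := key n le_rfl
  have m2 := hmap n
  have sA := hsA (n + 1)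
  have sB := hsB (n + 1) (by omega) le_rfl
  simp only [Nat.add_sub_cancel] at sA sB
  clear hmap hinj hsA hsB key
  rcases Nat.eq_zero_or_pos n with rfl | hi
  · grind
  · specialize m2 hi le_rfl
    specialize ih' hi
    generalize f (n, c + 1) = u at *
    rcases m2 with ⟨rfl, _⟩ | ⟨rfl, _⟩ | ⟨rfl, _⟩ | ⟨rfl, _⟩ <;> grind

theorem interlace_of_strip_matching {n c : ℕ} {A B : Finset ℕ} (hA : A ⊆ Finset.Icc 1 (n + 1))
    (hB : B ⊆ Finset.Icc 1 (n + 1)) {f : ℕ × ℕ → ℕ × ℕ}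
    (hf : f ∈ relMatchings adjC (whiteCol n (c + 1)) (blackStrip n c A B)) :
    Interlace n A B := by
  obtain ⟨h1, h2⟩ := countLE_of_strip_matching hA hB hf
  refine ⟨fun i hi => ?_, h2⟩
  rcases Nat.eq_zero_or_pos i with rfl | hpos
  · rw [countLE_zero hA, countLE_zero hB]
    omega
  · have h3 := h1 i hpos hi
    have h4 := (hf.2.1 (i, c + 1) (by simp [whiteCol, hi, hpos.ne', Nat.one_le_iff_ne_zero])).1
    simp only at h4
    omega

/-- The matching of a strip with shifts `s` in which the height-`v` white vertex is sent to the
left column exactly for those free heights `v` lying in `U`. -/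
noncomputable def stripMap (n c : ℕ) (A B : Finset ℕ) (s : ℕ → ℕ) (U : Finset ℕ) (p : ℕ × ℕ) :
    ℕ × ℕ :=
  if p ∈ whiteCol n (c + 1) then
    (p.1 + s p.1, if p.1 + s p.1 ∈ A ∧ (p.1 + s p.1 ∈ B ∨ (s p.1 = 0 ↔ p.1 + s p.1 ∈ U))
      then c else c + 1)
  else p

theorem mem_whiteCol {n c : ℕ} {p : ℕ × ℕ} :
    p ∈ whiteCol n c ↔ (1 ≤ p.1 ∧ p.1 ≤ n) ∧ p.2 = c := by
  simp only [whiteCol, Finset.mem_product, Finset.mem_Icc, Finset.mem_singleton]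

theorem mem_blackStrip {n c : ℕ} {A B : Finset ℕ} {q : ℕ × ℕ} :
    q ∈ blackStrip n c A B ↔
      (q.1 ∈ A ∧ q.2 = c) ∨ ((1 ≤ q.1 ∧ q.1 ≤ n + 1) ∧ q.1 ∉ B) ∧ q.2 = c + 1 := by
  simp only [blackStrip, Finset.mem_union, Finset.mem_product, Finset.mem_sdiff, Finset.mem_Icc,
    Finset.mem_singleton]

theorem stripMap_apply {n c : ℕ} (A B : Finset ℕ) (s : ℕ → ℕ) (U : Finset ℕ) {i : ℕ}
    (h1 : 1 ≤ i) (h2 : i ≤ n) :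
    stripMap n c A B s U (i, c + 1) =
      (i + s i, if i + s i ∈ A ∧ (i + s i ∈ B ∨ (s i = 0 ↔ i + s i ∈ U)) then c else c + 1) :=
  if_pos (mem_whiteCol.2 ⟨⟨h1, h2⟩, rfl⟩)

theorem stripMap_mem {n c : ℕ} {A B : Finset ℕ} (hA : A ⊆ Finset.Icc 1 (n + 1))
    {s : ℕ → ℕ} (hs0 : s 0 = 0) (hsn : s (n + 1) = 1) (hs1 : ∀ i ≤ n, s i ≤ 1)
    (hs : ∀ i ≤ n, s (i + 1) + (if i + 1 ∈ A then 1 else 0) = s i + if i + 1 ∈ B then 1 else 0)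
    (U : Finset ℕ) :
    stripMap n c A B s U ∈ relMatchings adjC (whiteCol n (c + 1)) (blackStrip n c A B) := by
  refine ⟨⟨?_, ?_, ?_⟩, ?_, fun p hp => if_neg hp⟩
  · rintro ⟨i, j⟩ hp
    obtain ⟨⟨h1, h2⟩, rfl⟩ := mem_whiteCol.1 hp
    simp only at h1 h2
    rw [stripMap_apply A B s U h1 h2, Finset.mem_coe, mem_blackStrip]
    obtain ⟨k, rfl⟩ : ∃ k, i = k + 1 := ⟨i - 1, by omega⟩
    have e1 := hs k (by omega)
    have e2 := hs (k + 1) h2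
    have e3 := hs1 (k + 1) h2
    have e4 : s (k + 2) ≤ 1 := by
      rcases Nat.lt_or_ge n (k + 2) with h | h
      · rw [show k + 2 = n + 1 by omega, hsn]
      · exact hs1 _ h
    rcases Nat.le_one_iff_eq_zero_or_eq_one.1 e3 with h | h <;> rw [h] at e1 e2 ⊢ <;>
      simp only [Nat.add_zero] <;> grind
  · have key : ∀ i j, 1 ≤ i → i ≤ n → 1 ≤ j → j ≤ n → i < j →
        stripMap n c A B s U (i, c + 1) ≠ stripMap n c A B s U (j, c + 1) := by
      intro i j h1 h2 h3 h4 hij h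
      rw [stripMap_apply A B s U h1 h2, stripMap_apply A B s U h3 h4, Prod.mk.injEq] at h
      have e1 := hs1 i h2
      have e2 := hs i h2
      have e3 := h.1
      obtain rfl : j = i + 1 := by omega
      have e4 : s i = 1 := by omega
      have e5 : s (i + 1) = 0 := by omega
      rw [e4, e5] at h e2
      simp only [Nat.add_zero] at h
      grind
    rintro ⟨i, j⟩ hp ⟨i', j'⟩ hp' h
    obtain ⟨⟨h1, h2⟩, rfl⟩ := mem_whiteCol.1 hp
    obtain ⟨⟨h3, h4⟩, rfl⟩ := mem_whiteCol.1 hp'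
    rcases lt_trichotomy i i' with hlt | rfl | hlt
    · exact absurd h (key i i' h1 h2 h3 h4 hlt)
    · rfl
    · exact absurd h.symm (key i' i h3 h4 h1 h2 hlt)
  · rintro ⟨v, j⟩ hq
    rw [Finset.mem_coe, mem_blackStrip] at hq
    simp only at hq
    have hv : 1 ≤ v ∧ v ≤ n + 1 := by
      rcases hq with ⟨h, -⟩ | ⟨⟨h, -⟩, -⟩
      · exact Finset.mem_Icc.1 (hA h)
      · exact h
    obtain ⟨k, rfl⟩ : ∃ k, v = k + 1 := ⟨v - 1, by omega⟩
    have e1 := hs k (by omega)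
    have e2 := hs1 k (by omega)
    have low : s (k + 1) = 0 → k + 1 ≤ n := by
      intro h
      by_contra hn
      rw [show k + 1 = n + 1 by omega] at h
      omega
    have high : s k = 1 → 1 ≤ k := by
      intro h
      by_contra hn
      rw [show k = 0 by omega] at h
      omega
    suffices h : (s (k + 1) = 0 ∧ stripMap n c A B s U (k + 1, c + 1) = (k + 1, j)) ∨
        (s k = 1 ∧ stripMap n c A B s U (k, c + 1) = (k + 1, j)) by
      rcases h with ⟨h, h'⟩ | ⟨h, h'⟩
      · exact ⟨_, mem_whiteCol.2 ⟨⟨by omega, low h⟩, rfl⟩, h'⟩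
      · exact ⟨_, mem_whiteCol.2 ⟨⟨high h, by omega⟩, rfl⟩, h'⟩
    have f1 : s (k + 1) = 0 → stripMap n c A B s U (k + 1, c + 1) =
        (k + 1, if k + 1 ∈ A ∧ (k + 1 ∈ B ∨ k + 1 ∈ U) then c else c + 1) := by
      intro h
      rw [stripMap_apply A B s U (by omega) (low h), h]
      simp
    have f2 : s k = 1 → stripMap n c A B s U (k, c + 1) =
        (k + 1, if k + 1 ∈ A ∧ (k + 1 ∈ B ∨ k + 1 ∉ U) then c else c + 1) := by
      intro h
      rw [stripMap_apply A B s U (high h) (by omega), h]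
      simp
    grind
  · rintro ⟨i, j⟩ hp
    obtain ⟨⟨h1, h2⟩, rfl⟩ := mem_whiteCol.1 hp
    simp only at h1 h2
    rw [stripMap_apply A B s U h1 h2]
    have := hs1 i h2
    refine ⟨by simp only; omega, ?_⟩
    simp only
    split_ifs
    · exact Or.inl rfl
    · exact Or.inr rfl

theorem relMatchCount_strip {n c : ℕ} {A B : Finset ℕ} (hA : A ⊆ Finset.Icc 1 (n + 1))
    (hB : B ⊆ Finset.Icc 1 (n + 1)) :
    relMatchCount adjC (whiteCol n (c + 1)) (blackStrip n c A B) =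
      if Interlace n A B then 2 ^ (A \ B).card else 0 := by
  split_ifs with hI
  swap
  · exact relMatchCount_eq_zero fun f hf => hI (interlace_of_strip_matching hA hB hf)
  obtain ⟨s, hsdef⟩ : ∃ s : ℕ → ℕ, ∀ i ≤ n + 1, countLE A i + s i = countLE B i := by
    refine ⟨fun i => countLE B i - countLE A i, fun i hi => ?_⟩
    rcases Nat.lt_or_ge n i with h | h
    · rw [show i = n + 1 by omega]
      have := hI.2
      simp only
      omega
    · have := hI.1 i h
      simp only
      omega
  have hs0 : s 0 = 0 := by
    have := hsdef 0 (by omega)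
    rw [countLE_zero hA, countLE_zero hB] at this
    omega
  have hsn : s (n + 1) = 1 := by
    have := hsdef (n + 1) le_rfl
    have := hI.2
    omega
  have hs1 : ∀ i ≤ n, s i ≤ 1 := fun i hi => by
    have := hI.1 i hi
    have := hsdef i (by omega)
    omega
  have hs : ∀ i ≤ n, s (i + 1) + (if i + 1 ∈ A then 1 else 0) =
      s i + if i + 1 ∈ B then 1 else 0 := fun i hi => by
    have h1 := hsdef i (by omega)
    have h2 := hsdef (i + 1) (by omega)
    rw [countLE_succ, countLE_succ] at h2
    omega
  have hfree : ∀ k, k ≤ n → k + 1 ∈ A → k + 1 ∉ B → k + 1 ≤ n ∧ s (k + 1) = 0 ∧ s k = 1 := by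
    intro k hk h1 h2
    have e1 := hs k hk
    have e2 := hs1 k hk
    rw [if_pos h1, if_neg h2] at e1
    have : k ≠ n := by
      rintro rfl
      omega
    omega
  rw [← Finset.card_powerset, ← Nat.card_eq_finsetCard, relMatchCount]
  refine (Nat.card_eq_of_bijective (fun U : (A \ B).powerset =>
    (⟨stripMap n c A B s U, stripMap_mem hA hs0 hsn hs1 hs U⟩ :
      relMatchings adjC (whiteCol n (c + 1)) (blackStrip n c A B))) ⟨?_, ?_⟩).symm
  · rintro ⟨U, hU⟩ ⟨U', hU'⟩ h
    have h' : ∀ p, stripMap n c A B s U p = stripMap n c A B s U' p :=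
      fun p => congrFun (congrArg Subtype.val h) p
    rw [Finset.mem_powerset] at hU hU'
    ext v
    by_cases hv : v ∈ A \ B
    · obtain ⟨hvA, hvB⟩ := Finset.mem_sdiff.1 hv
      have hv1 := Finset.mem_Icc.1 (hA hvA)
      obtain ⟨k, rfl⟩ : ∃ k, v = k + 1 := ⟨v - 1, by omega⟩
      obtain ⟨h1, h2, -⟩ := hfree k (by omega) hvA hvB
      have h3 := h' (k + 1, c + 1)
      rw [stripMap_apply A B s U (by omega) h1, stripMap_apply A B s U' (by omega) h1, h2] at h3
      simp only [Nat.add_zero, Prod.mk.injEq, true_and] at h3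
      grind
    · exact ⟨fun h => absurd (hU h) hv, fun h => absurd (hU' h) hv⟩
  · rintro ⟨f, hf⟩
    obtain ⟨hmap, hinj, hsA, hsB⟩ := strip_matching_local hf
    have hpos := (countLE_of_strip_matching hA hB hf).1
    refine ⟨⟨(A \ B).filter fun v => f (v, c + 1) = (v, c),
      Finset.mem_powerset.2 (Finset.filter_subset _ _)⟩, ?_⟩
    ext1
    funext ⟨i, j⟩
    by_cases hp : (i, j) ∈ whiteCol n (c + 1)
    swap
    · exact (if_neg hp).trans (hf.2.2 _ hp).symm
    obtain ⟨⟨h1, h2⟩, rfl⟩ := mem_whiteCol.1 hp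
    simp only at h1 h2
    simp only [stripMap_apply A B s _ h1 h2, Finset.mem_filter, Finset.mem_sdiff]
    have e1 : (f (i, c + 1)).1 = i + s i := by
      have := hpos i h1 h2
      have := hsdef i (by omega)
      omega
    have m1 := hmap i h1 h2
    rcases Nat.le_one_iff_eq_zero_or_eq_one.1 (hs1 i h2) with h | h
    · rw [h] at e1 ⊢
      clear hmap hinj hsA hsB hpos
      simp only [Nat.add_zero, true_iff] at e1 ⊢
      rcases m1 with ⟨m1, _⟩ | ⟨m1, _⟩ | ⟨m1, _⟩ | ⟨m1, _⟩ <;> rw [m1] at e1 ⊢ <;> grind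
    · rw [h] at e1 ⊢
      have e2 := hfree i h2
      have e3 := hsA (i + 1)
      have e4 := hsB (i + 1) (by omega) (by omega)
      have e5 := hinj i h1
      simp only [Nat.add_sub_cancel] at e3 e4
      clear hmap hinj hsA hsB hpos
      rcases m1 with ⟨m1, _⟩ | ⟨m1, _⟩ | ⟨m1, _⟩ | ⟨m1, _⟩ <;> rw [m1] at e1 e3 e4 e5 ⊢ <;> grind

/-- The white vertices of the `n × m` black-edged Aztec rectangle. -/
def whiteRect (n m : ℕ) : Finset (ℕ × ℕ) := Finset.Icc 1 n ×ˢ Finset.Icc 1 m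

/-- The black vertices of the `n × m` black-edged Aztec rectangle with dents `B`. -/
noncomputable def blackRect (n m : ℕ) (B : Finset ℕ) : Finset (ℕ × ℕ) :=
  (Finset.Icc 1 (n + 1) ×ˢ Finset.Icc 1 m).filter fun q => ¬(q.2 = m ∧ q.1 ∈ B)

theorem mem_whiteRect {n m : ℕ} {p : ℕ × ℕ} :
    p ∈ whiteRect n m ↔ (1 ≤ p.1 ∧ p.1 ≤ n) ∧ 1 ≤ p.2 ∧ p.2 ≤ m := by
  simp only [whiteRect, Finset.mem_product, Finset.mem_Icc]

theorem mem_blackRect {n m : ℕ} {B : Finset ℕ} {q : ℕ × ℕ} :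
    q ∈ blackRect n m B ↔
      ((1 ≤ q.1 ∧ q.1 ≤ n + 1) ∧ 1 ≤ q.2 ∧ q.2 ≤ m) ∧ ¬(q.2 = m ∧ q.1 ∈ B) := by
  simp only [blackRect, Finset.mem_filter, Finset.mem_product, Finset.mem_Icc]

theorem whiteRect_succ (n m : ℕ) : whiteRect n (m + 1) = whiteRect n m ∪ whiteCol n (m + 1) := by
  ext p
  rw [Finset.mem_union, mem_whiteRect, mem_whiteRect, mem_whiteCol]
  omega

theorem disjoint_whiteRect_whiteCol (n m : ℕ) :
    Disjoint (whiteRect n m) (whiteCol n (m + 1)) := by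
  rw [Finset.disjoint_left]
  intro p h1 h2
  rw [mem_whiteRect] at h1
  rw [mem_whiteCol] at h2
  omega

theorem blackRect_sdiff {n m : ℕ} (hm : 1 ≤ m) {A B : Finset ℕ}
    (hA : A ⊆ Finset.Icc 1 (n + 1)) :
    blackRect n (m + 1) B \ blackRect n m A = blackStrip n m A B := by
  ext ⟨i, j⟩
  rw [Finset.mem_sdiff, mem_blackRect, mem_blackRect, mem_blackStrip]
  have hA' : i ∈ A → 1 ≤ i ∧ i ≤ n + 1 := fun h => Finset.mem_Icc.1 (hA h)
  simp only
  grind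

theorem blackRect_subset {n m : ℕ} {A B : Finset ℕ} :
    blackRect n m A ⊆ blackRect n (m + 1) B := by
  intro q
  rw [mem_blackRect, mem_blackRect]
  omega

theorem blackRect_injOn {n m : ℕ} (hm : 1 ≤ m) :
    Set.InjOn (blackRect n m) (Finset.Icc 1 (n + 1)).powerset := by
  intro A hA A' hA' h
  simp only [Finset.coe_powerset, Set.mem_preimage, Set.mem_powerset_iff, Finset.coe_subset] at hA hA'
  ext i
  have h1 : (i, m) ∈ blackRect n m A ↔ (i, m) ∈ blackRect n m A' := by rw [h]
  rw [mem_blackRect, mem_blackRect] at h1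
  by_cases hi : i ∈ Finset.Icc 1 (n + 1)
  · have := Finset.mem_Icc.1 hi
    simp only [this, hm] at h1
    simpa [not_iff_not] using h1
  · exact ⟨fun h => absurd (hA h) hi, fun h => absurd (hA' h) hi⟩

theorem relMatchCount_rect_succ {n m : ℕ} (hm : 1 ≤ m) {B : Finset ℕ}
    (hB : B ⊆ Finset.Icc 1 (n + 1)) :
    relMatchCount adjC (whiteRect n (m + 1)) (blackRect n (m + 1) B) =
      ∑ A ∈ (Finset.Icc 1 (n + 1)).powerset,
        relMatchCount adjC (whiteRect n m) (blackRect n m A) *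
          if Interlace n A B then 2 ^ (A \ B).card else 0 := by
  rw [whiteRect_succ, relMatchCount_union adjC (disjoint_whiteRect_whiteCol n m)]
  symm
  refine Finset.sum_of_injOn (blackRect n m) (blackRect_injOn hm) ?_ ?_ ?_
  · intro A _
    exact Finset.mem_coe.2 (Finset.mem_powerset.2 blackRect_subset)
  · intro L hL hne
    rw [Finset.mem_powerset] at hL
    by_contra h
    obtain ⟨h1, h2⟩ := mul_ne_zero_iff.1 h
    have h1' : ∃ f, f ∈ relMatchings adjC (whiteRect n m) L := by
      by_contra! h'
      exact h1 (relMatchCount_eq_zero h')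
    have h2' : ∃ f, f ∈ relMatchings adjC (whiteCol n (m + 1)) (blackRect n (m + 1) B \ L) := by
      by_contra! h'
      exact h2 (relMatchCount_eq_zero h')
    obtain ⟨f, hf, hfr, -⟩ := h1'
    obtain ⟨g, hg, hgr, -⟩ := h2'
    have hLcol : ∀ q ∈ L, q.2 ≤ m := by
      intro q hq
      obtain ⟨p, hp, rfl⟩ := hf.surjOn hq
      have h3 := hfr p hp
      have h4 := mem_whiteRect.1 hp
      have h5 := h3.2
      omega
    have hcol : ∀ q ∈ blackRect n (m + 1) B, q.2 < m → q ∈ L := by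
      intro q hq hqm
      by_contra hqL
      obtain ⟨p, hp, rfl⟩ := hg.surjOn (Finset.mem_coe.2 (Finset.mem_sdiff.2 ⟨hq, hqL⟩))
      have h3 := (hgr p hp).2
      have h4 := mem_whiteCol.1 hp
      omega
    refine hne ⟨(Finset.Icc 1 (n + 1)).filter fun i => (i, m) ∉ L,
      Finset.mem_coe.2 (Finset.mem_powerset.2 (Finset.filter_subset _ _)), ?_⟩
    ext ⟨i, j⟩
    have h3 := hLcol (i, j)
    have h4 := hcol (i, j)
    have h5 := @hL (i, j)
    rw [mem_blackRect] at h4 h5 ⊢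
    simp only [Finset.mem_filter, Finset.mem_Icc] at h3 h4 h5 ⊢
    by_cases hj : j = m
    · subst hj
      by_cases hL' : (i, j) ∈ L
      · simp only [hL', true_imp_iff] at h5
        simp only [hL', not_true_eq_false, and_false, not_false_eq_true, and_true, iff_true]
        omega
      · simp only [hL', not_false_eq_true, and_true, true_and, iff_false]
        omega
    · by_cases hL' : (i, j) ∈ L
      · simp only [hL', true_imp_iff] at h3 h5
        simp only [hL', iff_true, hj, false_and, not_false_eq_true, and_true]
        omega
      · simp only [hL', iff_false, hj, false_and, not_false_eq_true, and_true] at h4 ⊢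
        intro h
        exact h4 ⟨⟨h.1, by omega, by omega⟩, fun h6 => by have := h6.1; omega⟩ (by omega)
  · intro A hA
    rw [Finset.mem_powerset] at hA
    rw [blackRect_sdiff hm hA, relMatchCount_strip hA hB]

theorem countLE_image_le {m : ℕ} (a : Fin m → ℕ) (v : ℕ) :
    countLE (Finset.univ.image a) v ≤ m :=
  (Finset.card_le_card (Finset.filter_subset _ _)).trans
    (Finset.card_image_le.trans (by simp))

theorem lt_countLE_image_iff {m : ℕ} {a : Fin m → ℕ} (ha : StrictMono a) (i : Fin m) (v : ℕ) :
    (i : ℕ) < countLE (Finset.univ.image a) v ↔ a i ≤ v := by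
  have h : countLE (Finset.univ.image a) v = (Finset.univ.filter fun k => a k ≤ v).card := by
    rw [countLE, Finset.filter_image, Finset.card_image_of_injective _ ha.injective]
  rw [h]
  constructor
  · intro hlt
    by_contra! hv
    have : (Finset.univ.filter fun k => a k ≤ v) ⊆ Finset.Iio i := by
      intro k hk
      rw [Finset.mem_Iio]
      exact ha.lt_iff_lt.1 ((Finset.mem_filter.1 hk).2.trans_lt hv)
    have := Finset.card_le_card this
    rw [Fin.card_Iio] at this
    omega
  · intro hv
    have : Finset.Iic i ⊆ Finset.univ.filter fun k => a k ≤ v := by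
      intro k hk
      exact Finset.mem_filter.2 ⟨Finset.mem_univ _, (ha.monotone (Finset.mem_Iic.1 hk)).trans hv⟩
    have := Finset.card_le_card this
    rw [Fin.card_Iic] at this
    omega

theorem countLE_of_subset {A : Finset ℕ} {n : ℕ} (hA : A ⊆ Finset.Icc 1 n) :
    countLE A n = A.card := by
  rw [countLE, Finset.filter_true_of_mem]
  exact fun a ha => (Finset.mem_Icc.1 (hA ha)).2

theorem interlace_image_iff {n m : ℕ} {a : Fin m → ℕ} {b : Fin (m + 1) → ℕ}
    (ha : StrictMono a) (hb : StrictMono b) (ha' : ∀ i, a i ∈ Finset.Icc 1 (n + 1))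
    (hb' : ∀ i, b i ∈ Finset.Icc 1 (n + 1)) :
    Interlace n (Finset.univ.image a) (Finset.univ.image b) ↔
      ∀ i, a i ∈ Finset.Icc (b i.castSucc) (b i.succ) := by
  have hA : Finset.univ.image a ⊆ Finset.Icc 1 (n + 1) := by
    simpa [Finset.image_subset_iff] using ha'
  have hB : Finset.univ.image b ⊆ Finset.Icc 1 (n + 1) := by
    simpa [Finset.image_subset_iff] using hb'
  constructor
  · rintro ⟨h1, h2⟩ i
    have h3 : ∀ v ≤ n + 1, countLE (Finset.univ.image a) v ≤ countLE (Finset.univ.image b) v ∧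
        countLE (Finset.univ.image b) v ≤ countLE (Finset.univ.image a) v + 1 := by
      intro v hv
      rcases Nat.lt_or_ge n v with h | h
      · rw [show v = n + 1 by omega]
        omega
      · exact h1 v h
    rw [Finset.mem_Icc]
    constructor
    · rw [← lt_countLE_image_iff hb]
      have := (lt_countLE_image_iff ha i (a i)).2 le_rfl
      have := h3 (a i) (Finset.mem_Icc.1 (ha' i)).2
      rw [Fin.val_castSucc]
      omega
    · rw [← lt_countLE_image_iff ha]
      have := (lt_countLE_image_iff hb i.succ (b i.succ)).2 le_rfl
      have := h3 (b i.succ) (Finset.mem_Icc.1 (hb' i.succ)).2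
      rw [Fin.val_succ] at *
      omega
  · intro h
    refine ⟨fun v _ => ⟨?_, ?_⟩, ?_⟩
    · by_contra! hlt
      have hm := countLE_image_le a v
      have h1 := (lt_countLE_image_iff ha ⟨_, hlt.trans_le hm⟩ v).1 hlt
      have h2 := (lt_countLE_image_iff hb _ v).2 ((Finset.mem_Icc.1 (h _)).1.trans h1)
      simp at h2
    · by_contra! hlt
      have hm := countLE_image_le b v
      have h1 := (lt_countLE_image_iff hb
        (Fin.succ ⟨countLE (Finset.univ.image a) v, by omega⟩) v).1 hlt
      have h2 := (lt_countLE_image_iff ha _ v).2 ((Finset.mem_Icc.1 (h _)).2.trans h1)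
      simp at h2
    · rw [countLE_of_subset hA, countLE_of_subset hB, Finset.card_image_of_injective _ ha.injective,
        Finset.card_image_of_injective _ hb.injective]
      simp

theorem prod_trapezoid_weights {m : ℕ} {a : Fin m → ℕ} {b : Fin (m + 1) → ℕ}
    (ha : StrictMono a) (hb : StrictMono b)
    (h : ∀ i, a i ∈ Finset.Icc (b i.castSucc) (b i.succ)) :
    (∏ i, ((if b i.castSucc < a i then 1 else 0) + if a i < b i.succ then 1 else 0 : ℚ)) =
      2 ^ (Finset.univ.image a \ Finset.univ.image b).card := by
  have hw : ∀ i, ((if b i.castSucc < a i then 1 else 0) + if a i < b i.succ then 1 else 0 : ℚ) =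
      if a i ∉ Finset.univ.image b then 2 else 1 := by
    intro i
    obtain ⟨h1, h2⟩ := Finset.mem_Icc.1 (h i)
    have h3 : b i.castSucc < b i.succ := hb Fin.castSucc_lt_succ
    have h4 : a i ∈ Finset.univ.image b ↔ a i = b i.castSucc ∨ a i = b i.succ := by
      constructor
      · intro hmem
        obtain ⟨k, -, hk⟩ := Finset.mem_image.1 hmem
        rcases le_or_gt k i.castSucc with hle | hgt
        · have := hb.monotone hle
          omega
        · have := hb.monotone (Fin.castSucc_lt_iff_succ_le.1 hgt)
          omega
      · rintro (h | h) <;> rw [h] <;> exact Finset.mem_image_of_mem _ (Finset.mem_univ _)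
    simp only [h4]
    rcases eq_or_lt_of_le h1 with h5 | h5
    · have : a i < b i.succ := by omega
      simp [← h5, h3]
    · rcases eq_or_lt_of_le h2 with h6 | h6
      · simp [h6, h3]
      · simp [h5, h6, h5.ne', h6.ne]
        norm_num
  simp_rw [hw]
  rw [← Finset.prod_image (s := Finset.univ) (g := a)
    (f := fun v => if v ∉ Finset.univ.image b then (2 : ℚ) else 1) (fun i _ j _ h => ha.injective h),
    ← Finset.prod_filter, Finset.prod_const, Finset.sdiff_eq_filter]

theorem sum_interlace_eq {n m : ℕ} {b : Fin (m + 1) → ℕ} (hb : StrictMono b)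
    (hb' : ∀ i, b i ∈ Finset.Icc 1 (n + 1)) (F : Finset ℕ → ℚ) (K : ℚ)
    (hF : ∀ a : Fin m → ℕ, StrictMono a → (∀ i, a i ∈ Finset.Icc 1 (n + 1)) →
      F (Finset.univ.image a) = K * (chooseMatrix a).det) :
    ∑ A ∈ (Finset.Icc 1 (n + 1)).powerset,
      F A * (if Interlace n A (Finset.univ.image b)
        then 2 ^ (A \ Finset.univ.image b).card else 0) = K * (2 ^ m * (chooseMatrix b).det) := by
  rw [two_pow_mul_det_chooseMatrix_eq_sum b hb.monotone, Finset.mul_sum]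
  symm
  rw [← Finset.sum_filter_of_ne (p := StrictMono)]
  swap
  · intro a ha hne
    rw [Fintype.mem_piFinset] at ha
    have hmono : Monotone a := by
      intro i j hij
      rcases eq_or_lt_of_le hij with rfl | hlt
      · exact le_rfl
      · have h1 := (Finset.mem_Icc.1 (ha i)).2
        have h2 := (Finset.mem_Icc.1 (ha j)).1
        exact h1.trans ((hb.monotone (Fin.succ_le_castSucc_iff.2 hlt)).trans h2)
    refine hmono.strictMono_of_injective fun i j hij => ?_
    by_contra hne'
    refine hne ?_
    rw [Matrix.det_zero_of_row_eq hne', mul_zero, mul_zero]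
    funext k
    simp [chooseMatrix, hij]
  have hmem : ∀ a : Fin m → ℕ, (∀ i, a i ∈ Finset.Icc (b i.castSucc) (b i.succ)) →
      ∀ i, a i ∈ Finset.Icc 1 (n + 1) := by
    intro a ha i
    have h1 := Finset.mem_Icc.1 (ha i)
    have h2 := Finset.mem_Icc.1 (hb' i.castSucc)
    have h3 := Finset.mem_Icc.1 (hb' i.succ)
    rw [Finset.mem_Icc]
    omega
  refine Finset.sum_of_injOn (fun a => Finset.univ.image a) ?_ ?_ ?_ ?_
  · intro a ha a' ha' h
    have h1 := (Finset.mem_filter.1 ha).2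
    have h2 := (Finset.mem_filter.1 ha').2
    have h3 : Set.range a = Set.range a' := by
      have := congrArg (fun s : Finset ℕ => (s : Set ℕ)) h
      simpa using this
    exact (StrictMono.range_inj h1 h2).1 h3
  · intro a ha
    obtain ⟨h1, h2⟩ := Finset.mem_filter.1 ha
    rw [Finset.mem_coe, Finset.mem_powerset, Finset.image_subset_iff]
    exact fun i _ => hmem a (Fintype.mem_piFinset.1 h1) i
  · intro A hA hne
    rw [Finset.mem_powerset] at hA
    rw [if_neg, mul_zero]
    intro hI
    refine hne ?_
    have hcard : A.card = m := by
      have h1 := hI.2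
      have hB : Finset.univ.image b ⊆ Finset.Icc 1 (n + 1) := by
        simpa [Finset.image_subset_iff] using hb'
      rw [countLE_of_subset hA, countLE_of_subset hB,
        Finset.card_image_of_injective _ hb.injective] at h1
      simpa using h1.symm
    have himg : Finset.univ.image (A.orderEmbOfFin hcard) = A := by
      apply Finset.coe_injective
      simp
    have hmono : StrictMono (A.orderEmbOfFin hcard) := (A.orderEmbOfFin hcard).strictMono
    refine ⟨A.orderEmbOfFin hcard, ?_, himg⟩
    refine Finset.mem_coe.2 (Finset.mem_filter.2 ⟨Fintype.mem_piFinset.2 ?_, hmono⟩)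
    refine (interlace_image_iff hmono hb (fun i => hA (A.orderEmbOfFin_mem hcard i)) hb').1 ?_
    rwa [himg]
  · intro a ha
    obtain ⟨h1, h2⟩ := Finset.mem_filter.1 ha
    rw [Fintype.mem_piFinset] at h1
    have h3 := hmem a h1
    rw [hF a h2 h3, if_pos ((interlace_image_iff h2 hb h3 hb').2 h1),
      prod_trapezoid_weights h2 hb h1]
    ring

theorem relMatchCount_rect {n m : ℕ} (b : Fin (m + 1) → ℕ) (hb : StrictMono b)
    (hb' : ∀ i, b i ∈ Finset.Icc 1 (n + 1)) :
    (relMatchCount adjC (whiteRect n (m + 1)) (blackRect n (m + 1) (Finset.univ.image b)) : ℚ) =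
      2 ^ ((m + 1) * m / 2) * (chooseMatrix b).det := by
  have himg {k : ℕ} (b : Fin k → ℕ) (hb' : ∀ i, b i ∈ Finset.Icc 1 (n + 1)) :
      Finset.univ.image b ⊆ Finset.Icc 1 (n + 1) := by
    simpa [Finset.image_subset_iff] using hb'
  induction m with
  | zero =>
    have hW : whiteRect n 1 = whiteCol n (0 + 1) := by
      ext p
      rw [mem_whiteRect, mem_whiteCol]
      omega
    have hK : blackRect n 1 (Finset.univ.image b) =
        blackStrip n 0 (Finset.univ.image Fin.elim0) (Finset.univ.image b) := by
      ext q
      rw [mem_blackRect, mem_blackStrip]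
      simp only [Finset.univ_eq_empty, Finset.image_empty, Finset.notMem_empty, false_and, false_or]
      grind
    rw [show relMatchCount adjC (whiteRect n (0 + 1)) (blackRect n (0 + 1) (Finset.univ.image b)) =
      relMatchCount adjC (whiteCol n (0 + 1)) (blackStrip n 0 (Finset.univ.image Fin.elim0)
        (Finset.univ.image b)) from congrArg₂ _ hW hK, relMatchCount_strip (himg _ fun i => i.elim0) (himg b hb'), if_pos]
    · simp [chooseMatrix]
    · exact (interlace_image_iff (fun i => i.elim0) hb (fun i => i.elim0) hb').2 fun i => i.elim0
  | succ m ih =>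
    rw [relMatchCount_rect_succ (by omega) (himg b hb')]
    push_cast
    rw [sum_interlace_eq hb hb'
      (fun A => (relMatchCount adjC (whiteRect n (m + 1)) (blackRect n (m + 1) A) : ℚ))
      (2 ^ ((m + 1) * m / 2)) ih, ← mul_assoc, ← pow_add]
    congr 2
    rw [show (m + 1 + 1) * (m + 1) = (m + 1) * m + (m + 1) * 2 by ring,
      Nat.add_mul_div_right _ _ two_pos]

/-- The subgraph of the coloured grid formed by the edges joining `p ∈ W` to `f p`. -/
def matchingSubgraph (W K : Finset (ℕ × ℕ)) (S : Set (Bool × ℕ × ℕ))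
    (hW : ∀ p, (false, p) ∈ S ↔ p ∈ W) (hK : ∀ q, (true, q) ∈ S ↔ q ∈ K)
    (f : relMatchings adjC W K) : coloredGrid.Subgraph where
  verts := S
  Adj u v := (u.1 = false ∧ u.2 ∈ W ∧ v = (true, f.1 u.2)) ∨
    (v.1 = false ∧ v.2 ∈ W ∧ u = (true, f.1 v.2))
  adj_sub := by
    rintro ⟨_, p⟩ ⟨_, q⟩ (⟨rfl, h, h'⟩ | ⟨rfl, h, h'⟩)
    · cases h'
      exact Or.inl ⟨rfl, rfl, f.2.2.1 p h⟩
    · cases h'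
      exact Or.inr ⟨rfl, rfl, f.2.2.1 q h⟩
  edge_vert := by
    rintro ⟨_, p⟩ ⟨_, q⟩ (⟨rfl, h, h'⟩ | ⟨rfl, h, h'⟩)
    · exact (hW p).2 h
    · cases h'
      exact (hK _).2 (f.2.1.mapsTo h)
  symm := ⟨fun _ _ h => h.symm⟩

theorem matchCount_coloredGrid {W K : Finset (ℕ × ℕ)} {S : Set (Bool × ℕ × ℕ)}
    (hW : ∀ p, (false, p) ∈ S ↔ p ∈ W) (hK : ∀ q, (true, q) ∈ S ↔ q ∈ K) :
    matchCount coloredGrid S = relMatchCount adjC W K := by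
  symm
  refine Nat.card_eq_of_bijective (fun f : relMatchings adjC W K =>
    (⟨matchingSubgraph W K S hW hK f, rfl, ?_⟩ :
      {M : coloredGrid.Subgraph // M.verts = S ∧ M.IsMatching})) ⟨?_, ?_⟩
  · rintro ⟨_ | _, p⟩ hp
    · have hpW := (hW p).1 hp
      refine ⟨(true, f.1 p), Or.inl ⟨rfl, hpW, rfl⟩, ?_⟩
      rintro w (⟨-, -, h⟩ | ⟨-, -, h⟩)
      · exact h
      · cases h
    · obtain ⟨q, hq, rfl⟩ := f.2.1.surjOn ((hK p).1 hp)
      refine ⟨(false, q), Or.inr ⟨rfl, hq, rfl⟩, ?_⟩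
      rintro ⟨_, w⟩ (⟨h, -, -⟩ | ⟨rfl, h, h'⟩)
      · cases h
      · rw [Prod.mk.injEq] at h'
        rw [f.2.1.injOn hq h h'.2]
  · intro f g h
    have h' : matchingSubgraph W K S hW hK f = matchingSubgraph W K S hW hK g :=
      congrArg Subtype.val h
    ext1
    funext p
    by_cases hp : p ∈ W
    · have h1 : (matchingSubgraph W K S hW hK f).Adj (false, p) (true, f.1 p) :=
        Or.inl ⟨rfl, hp, rfl⟩
      rw [h'] at h1
      rcases h1 with ⟨-, -, h1⟩ | ⟨h1, -⟩
      · exact (Prod.mk.inj h1).2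
      · cases h1
    · rw [f.2.2.2 p hp, g.2.2.2 p hp]
  · rintro ⟨M, rfl, hM⟩
    have hex : ∀ p ∈ W, ∃ q, M.Adj (false, p) (true, q) := by
      intro p hp
      obtain ⟨⟨_ | _, q⟩, hw, -⟩ := hM ((hW p).2 hp)
      · rcases M.adj_sub hw with ⟨-, h, -⟩ | ⟨-, h, -⟩ <;> cases h
      · exact ⟨q, hw⟩
    choose! g hg using hex
    have hadj : ∀ p ∈ W, ∀ q, M.Adj (false, p) (true, q) ↔ q = g p := by
      intro p hp q
      constructor
      · intro h
        exact (Prod.mk.inj ((hM ((hW p).2 hp)).unique h (hg p hp))).2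
      · rintro rfl
        exact hg p hp
    have hmem : (fun p => if p ∈ W then g p else p) ∈ relMatchings adjC W K := by
      refine ⟨Set.BijOn.congr (f₁ := g) ⟨?_, ?_, ?_⟩ fun p hp => (if_pos hp).symm, ?_,
        fun p hp => if_neg hp⟩
      · intro p hp
        exact (hK _).1 (M.edge_vert (hg p hp).symm)
      · intro p hp q hq h
        have h1 := (hg p hp).symm
        have h2 := (hg q hq).symm
        rw [← h] at h2
        exact (Prod.mk.inj ((hM (M.edge_vert h1)).unique h1 h2)).2
      · intro q hq
        obtain ⟨⟨_ | _, p⟩, hw, -⟩ := hM ((hK q).2 hq)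
        · have hp : p ∈ W := (hW p).1 (M.edge_vert hw.symm)
          exact ⟨p, hp, ((hadj p hp q).1 hw.symm).symm⟩
        · rcases M.adj_sub hw with ⟨h, -, -⟩ | ⟨h, -, -⟩ <;> cases h
      · intro p hp
        simp only [hp, if_true]
        rcases M.adj_sub (hg p hp) with ⟨-, -, h⟩ | ⟨h, -, -⟩
        · exact h
        · cases h
    refine ⟨⟨_, hmem⟩, ?_⟩
    ext1
    have hwb : ∀ p q, (matchingSubgraph W K M.verts hW hK ⟨_, hmem⟩).Adj (false, p) (true, q) ↔
        M.Adj (false, p) (true, q) := by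
      intro p q
      constructor
      · rintro (⟨-, h, h'⟩ | ⟨h, -⟩)
        · have h2 := (Prod.mk.inj h').2
          exact (hadj p h q).2 (h2.trans (if_pos h))
        · cases h
      · intro h
        have hp : p ∈ W := (hW p).1 (M.edge_vert h)
        refine Or.inl ⟨rfl, hp, ?_⟩
        rw [(hadj p hp q).1 h]
        simp [hp]
    refine SimpleGraph.Subgraph.ext rfl ?_
    ext ⟨_ | _, p⟩ ⟨_ | _, q⟩
    · refine iff_of_false (fun h => ?_) fun h => ?_
      · rcases h with ⟨-, -, h⟩ | ⟨-, -, h⟩ <;> cases h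
      · rcases M.adj_sub h with ⟨-, h, -⟩ | ⟨-, h, -⟩ <;> cases h
    · exact hwb p q
    · rw [SimpleGraph.Subgraph.adj_comm, M.adj_comm]
      exact hwb q p
    · refine iff_of_false (fun h => ?_) fun h => ?_
      · rcases h with ⟨h, -, -⟩ | ⟨h, -, -⟩ <;> cases h
      · rcases M.adj_sub h with ⟨h, -, -⟩ | ⟨h, -, -⟩ <;> cases h

/-- EKLP Lemma, first part: the number of perfect matchings of the `n × m` black-edged Aztec
rectangle with dents at `x 1 < x 2 < … < x m` is
`2^(m(m-1)/2) · (∏_{i<j} (x j - x i)) / (∏_{k=1}^{m-1} k!)`. -/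
theorem eklp_black_rectangle (n m : ℕ) (hn : 1 ≤ n) (hm : 1 ≤ m) (hmn : m ≤ n + 1)
    (x : Fin m → ℕ) (hx : StrictMono x) (hxb : ∀ i, 1 ≤ x i ∧ x i ≤ n + 1) :
    (matchCount coloredGrid (blackRectVerts n m (Set.range x)) : ℚ)
      = 2 ^ (m * (m - 1) / 2) *
          (∏ p ∈ Finset.univ.filter (fun p : Fin m × Fin m => p.1 < p.2),
            ((x p.2 : ℚ) - (x p.1 : ℚ)))
        / (∏ k ∈ Finset.Icc 1 (m - 1), (Nat.factorial k : ℚ)) := by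
  obtain ⟨k, rfl⟩ : ∃ k, m = k + 1 := ⟨m - 1, by omega⟩
  rw [matchCount_coloredGrid (W := whiteRect n (k + 1))
      (K := blackRect n (k + 1) (Finset.univ.image x)),
    relMatchCount_rect x hx fun i => Finset.mem_Icc.2 (hxb i), det_chooseMatrix, mul_div_assoc]
  · rfl
  · intro p
    rw [mem_whiteRect]
    simp [blackRectVerts, and_assoc]
  · intro q
    rw [mem_blackRect]
    have h : q.1 ∈ Finset.univ.image x ↔ q.1 ∈ Set.range x := by simp
    rw [h]
    simp only [blackRectVerts, Set.mem_ofPred_eq, Bool.true_eq_false, false_and, false_or, true_and]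
    grind
end

section
/- Let n, w, d be integers with 1 ≤ w ≤ n and 1 ≤ d ≤ n. In the ring ℚ[[x]] of formal power series over ℚ, the coefficient of x^{w-1} in (1+x)^{d-1} · ((2+x)^{-1})^{n+1-w}, where (2+x)^{-1} denotes the multiplicative inverse of 2+x in ℚ[[x]], equals 2^{-n} times the coefficient of z^{w-1} in the polynomial (1+z)^{d-1} · (1-z)^{n-d}. -/
theorem constantCoeff_two_add_X :
    PowerSeries.constantCoeff (2 + PowerSeries.X : PowerSeries ℚ) = 2 := by
  rw [map_add, PowerSeries.constantCoeff_X, add_zero]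
  exact map_ofNat PowerSeries.constantCoeff 2

/-- `2 + X` is cancelled by one factor of a positive power of its inverse. -/
theorem two_add_X_mul_inv_pow_succ (k : ℕ) :
    (2 + PowerSeries.X : PowerSeries ℚ) * (2 + PowerSeries.X)⁻¹ ^ (k + 1)
      = (2 + PowerSeries.X)⁻¹ ^ k := by
  have h : (2 + PowerSeries.X : PowerSeries ℚ) * (2 + PowerSeries.X)⁻¹ = 1 :=
    PowerSeries.mul_inv_cancel _ (by simp [constantCoeff_two_add_X, -map_add])
  rw [pow_succ', ← mul_assoc, h, one_mul]

/-- The coefficients of negative powers of `2 + X` are scaled coefficients of powers of `1 - X`. -/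
theorem coeff_two_add_X_inv_pow (a k c : ℕ) (h : c + 1 = a + k) :
    PowerSeries.coeff a ((2 + PowerSeries.X : PowerSeries ℚ)⁻¹ ^ k)
      = (1 / 2) ^ (a + k) * ((1 - Polynomial.X) ^ c : Polynomial ℚ).coeff a := by
  induction c generalizing a k with
  | zero =>
    obtain ⟨rfl, rfl⟩ | ⟨rfl, rfl⟩ : a = 0 ∧ k = 1 ∨ a = 1 ∧ k = 0 := by omega
    · simp [constantCoeff_two_add_X, -map_add]
    · simp [PowerSeries.coeff_one, Polynomial.coeff_one]
  | succ c ih =>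
    rcases a with _ | a
    · simp [Polynomial.coeff_zero_eq_eval_zero, constantCoeff_two_add_X, -map_add]
    rcases k with _ | k
    · have hdeg : ((1 - Polynomial.X) ^ (c + 1) : Polynomial ℚ).natDegree < a + 1 := by
        have : ((1 - Polynomial.X) ^ (c + 1) : Polynomial ℚ).natDegree ≤ c + 1 := by
          compute_degree
        omega
      simp [PowerSeries.coeff_one, Polynomial.coeff_eq_zero_of_natDegree_lt hdeg]
    have hrec := congrArg (PowerSeries.coeff (a + 1)) (two_add_X_mul_inv_pow_succ k)
    rw [add_mul, two_mul, map_add, map_add, PowerSeries.coeff_succ_X_mul,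
      ih (a + 1) k (by omega), ih a (k + 1) (by omega)] at hrec
    rw [pow_succ (1 - Polynomial.X : Polynomial ℚ), mul_sub, mul_one, Polynomial.coeff_sub,
      Polynomial.coeff_mul_X]
    rw [show a + (k + 1) = a + k + 1 by ring, show a + 1 + k = a + k + 1 by ring] at hrec
    rw [show a + 1 + (k + 1) = a + k + 1 + 1 by ring, pow_succ (1 / 2 : ℚ)]
    linarith

/-- The substitution `z = x / (2 + x)` at the level of coefficients. -/
theorem coeff_one_add_X_pow_mul_two_add_X_inv_pow (a b c k : ℕ) (h : b + c + 1 = a + k) :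
    PowerSeries.coeff a ((1 + PowerSeries.X) ^ b * (2 + PowerSeries.X : PowerSeries ℚ)⁻¹ ^ k)
      = (1 / 2) ^ (a + k) *
        ((1 + Polynomial.X) ^ b * (1 - Polynomial.X) ^ c : Polynomial ℚ).coeff a := by
  induction b generalizing c k with
  | zero => simpa using coeff_two_add_X_inv_pow a k c (by omega)
  | succ b ih =>
    rcases k with _ | k
    · have hleft : ((1 + Polynomial.X) ^ (b + 1) : Polynomial ℚ).natDegree ≤ b + 1 := by
        compute_degree
      have hprod : ((1 + Polynomial.X) ^ (b + 1) * (1 - Polynomial.X) ^ c :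
          Polynomial ℚ).natDegree ≤ b + 1 + c := by
        compute_degree
      have hcoe : (1 + PowerSeries.X : PowerSeries ℚ) ^ (b + 1)
          = (((1 + Polynomial.X) ^ (b + 1) : Polynomial ℚ) : PowerSeries ℚ) := by simp
      rw [pow_zero, mul_one, hcoe, Polynomial.coeff_coe,
        Polynomial.coeff_eq_zero_of_natDegree_lt (by omega),
        Polynomial.coeff_eq_zero_of_natDegree_lt (by omega), mul_zero]
    have hseries : (1 + PowerSeries.X) ^ (b + 1) * (2 + PowerSeries.X : PowerSeries ℚ)⁻¹ ^ (k + 1)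
        = (1 + PowerSeries.X) ^ b * (2 + PowerSeries.X : PowerSeries ℚ)⁻¹ ^ k
          - (1 + PowerSeries.X) ^ b * (2 + PowerSeries.X : PowerSeries ℚ)⁻¹ ^ (k + 1) := by
      rw [← two_add_X_mul_inv_pow_succ k]
      ring
    have hpoly : ((1 + Polynomial.X) ^ (b + 1) * (1 - Polynomial.X) ^ c : Polynomial ℚ)
        = Polynomial.C 2 * ((1 + Polynomial.X) ^ b * (1 - Polynomial.X) ^ c)
          - (1 + Polynomial.X) ^ b * (1 - Polynomial.X) ^ (c + 1) := by
      rw [map_ofNat]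
      ring
    rw [hseries, hpoly, map_sub, ih c k (by omega), ih (c + 1) (k + 1) (by omega),
      Polynomial.coeff_sub, Polynomial.coeff_C_mul, ← add_assoc, pow_succ]
    ring

/-- The coefficient of `x^(w-1)` in the formal power series
`(1+x)^(d-1) · ((2+x)⁻¹)^(n+1-w)` over `ℚ` equals `2^(-n)` times the coefficient of
`z^(w-1)` in the polynomial `(1+z)^(d-1) (1-z)^(n-d)`. -/
theorem coeff_inverse_series_krawtchouk (n w d : ℕ)
    (hw1 : 1 ≤ w) (hwn : w ≤ n) (hd1 : 1 ≤ d) (hdn : d ≤ n) :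
    PowerSeries.coeff (R := ℚ) (w - 1)
        ((1 + PowerSeries.X) ^ (d - 1) *
          (((2 + PowerSeries.X : PowerSeries ℚ))⁻¹) ^ (n + 1 - w))
      = 2 ^ (-(n : ℤ)) *
        ((1 + Polynomial.X) ^ (d - 1) * (1 - Polynomial.X) ^ (n - d) :
          Polynomial ℚ).coeff (w - 1) := by
  rw [coeff_one_add_X_pow_mul_two_add_X_inv_pow (w - 1) (d - 1) (n - d) (n + 1 - w) (by omega),
    show w - 1 + (n + 1 - w) = n by omega, zpow_neg, zpow_natCast, one_div, inv_pow]
end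

section
/- For every polynomial f ∈ ℚ[X] and every integer m ≥ 0, the coefficient of X^m in the polynomial (1+X)^m · f(X) equals the coefficient of X^m in the formal power series (1-X)^{-1} · f(X·(1-X)^{-1}), where (1-X)^{-1} denotes the multiplicative inverse of 1-X in ℚ[[X]] and f(X·(1-X)^{-1}) denotes the evaluation of the polynomial f at the formal power series X·(1-X)^{-1}. -/
namespace PowerSeries

theorem inv_one_sub_X {k : Type*} [Field k] : (1 - X : PowerSeries k)⁻¹ = mk 1 := by
  rw [PowerSeries.inv_eq_iff_mul_eq_one (by simp)]
  exact mk_one_mul_one_sub_eq_one k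

/-- The coefficients of `(1 - X)⁻¹ * (X * (1 - X)⁻¹) ^ j` are the binomial coefficients
in column `j`. -/
theorem coeff_inv_one_sub_X_mul_pow {k : Type*} [Field k] (m j : ℕ) :
    coeff m ((1 - X : PowerSeries k)⁻¹ * (X * (1 - X : PowerSeries k)⁻¹) ^ j) =
      (m.choose j : k) := by
  have h : (1 - X : PowerSeries k)⁻¹ * (X * (1 - X : PowerSeries k)⁻¹) ^ j
      = X ^ j * mk fun n ↦ ((j + n).choose j : k) := by
    rw [← mk_one_pow_eq_mk_choose_add, inv_one_sub_X]
    ring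
  rw [h, coeff_X_pow_mul']
  split_ifs with hj
  · rw [coeff_mk, Nat.add_sub_cancel' hj]
  · rw [Nat.choose_eq_zero_of_lt (not_le.mp hj), Nat.cast_zero]

end PowerSeries

theorem Polynomial.coeff_one_add_X_pow_mul_X_pow {R : Type*} [CommSemiring R] (m j : ℕ) :
    ((1 + X : Polynomial R) ^ m * X ^ j).coeff m = (m.choose j : R) := by
  rw [coeff_mul_X_pow']
  split_ifs with hj
  · rw [coeff_one_add_X_pow, Nat.choose_symm hj]
  · rw [Nat.choose_eq_zero_of_lt (not_le.mp hj), Nat.cast_zero]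

/-- For any polynomial `f` over `ℚ` and any `m ≥ 0`, the coefficient of `X^m` in the
polynomial `(1+X)^m · f(X)` equals the coefficient of `X^m` in the formal power series
`(1-X)⁻¹ · f(X·(1-X)⁻¹)`. -/
theorem coeff_substitution_identity (f : Polynomial ℚ) (m : ℕ) :
    ((1 + Polynomial.X) ^ m * f).coeff m
      = PowerSeries.coeff m
          (((1 - PowerSeries.X : PowerSeries ℚ))⁻¹ *
            Polynomial.aeval
              ((PowerSeries.X : PowerSeries ℚ) * ((1 - PowerSeries.X : PowerSeries ℚ))⁻¹)
              f) := by
  induction f using Polynomial.induction_on' with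
  | add p q hp hq => rw [map_add, mul_add, mul_add, map_add, Polynomial.coeff_add, hp, hq]
  | monomial j a =>
    rw [← Polynomial.C_mul_X_pow_eq_monomial, ← Polynomial.smul_eq_C_mul, map_smul,
      mul_smul_comm, mul_smul_comm, Polynomial.coeff_smul, map_smul, map_pow, Polynomial.aeval_X,
      Polynomial.coeff_one_add_X_pow_mul_X_pow, PowerSeries.coeff_inv_one_sub_X_mul_pow]
end
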